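/- arXiv:1603.00384 — 3 statements merged into one kernel-verified Lean document; each statement's English description precedes it below -/
import Mathlib

section
/- Let d ≥ 1 and let D be a linearly repetitive Delone set in ℝ^d. Then there exists a bi-Lipschitz homeomorphism H : ℝ^d → ℝ^d such that H(D) is a boundedly displaced image of ℤ^d: there exists a bijection Φ : H(D) → ℤ^d and a constant M such that ‖Φ(H(v)) − H(v)‖ ≤ M for all v ∈ D. -/
/-- The integer lattice ℤ^d inside `EuclideanSpace ℝ (Fin d)`:
the set of points all of whose coordinates are integers. -/
def intLattice (d : ℕ) : Set (EuclideanSpace ℝ (Fin d)) :=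
  {x | ∀ i : Fin d, ∃ n : ℤ, x i = (n : ℝ)}

open MeasureTheory Filter Topology

/-- A function with derivative at least one increases at least as fast as the identity. -/
lemma sub_le_sub_of_one_le_deriv {F p : ℝ → ℝ} (hF : ∀ t, HasDerivAt F (p t) t)
    (hp : ∀ t, 1 ≤ p t) {s t : ℝ} (hst : s ≤ t) : t - s ≤ F t - F s := by
  have hmono : Monotone fun t => F t - t := by
    apply monotone_of_hasDerivAt_nonneg (f' := fun t => p t - 1)
    · intro t
      exact (hF t).sub (hasDerivAt_id t)
    · intro t
      simpa using hp t
  have := hmono hst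
  simp only at this
  linarith

lemma abs_sub_le_abs_sub_of_one_le_deriv {F p : ℝ → ℝ} (hF : ∀ t, HasDerivAt F (p t) t)
    (hp : ∀ t, 1 ≤ p t) (s t : ℝ) : |s - t| ≤ |F s - F t| := by
  rcases le_total s t with h | h
  · have := sub_le_sub_of_one_le_deriv hF hp h
    rw [abs_sub_comm s, abs_sub_comm (F s)]
    rwa [abs_of_nonneg (by linarith), abs_of_nonneg (by linarith)]
  · have := sub_le_sub_of_one_le_deriv hF hp h
    rwa [abs_of_nonneg (by linarith), abs_of_nonneg (by linarith)]

lemma bijective_of_one_le_deriv {F p : ℝ → ℝ} (hF : ∀ t, HasDerivAt F (p t) t)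
    (hp : ∀ t, 1 ≤ p t) : Function.Bijective F := by
  constructor
  · intro s t hst
    have := abs_sub_le_abs_sub_of_one_le_deriv hF hp s t
    rw [hst, sub_self, abs_zero] at this
    exact sub_eq_zero.1 (abs_nonpos_iff.1 this)
  · have hcont : Continuous F := continuous_iff_continuousAt.2 fun t => (hF t).continuousAt
    apply hcont.surjective
    · apply Filter.tendsto_atTop_mono' _ _ (Filter.tendsto_atTop_add_const_left _ (F 0)
        Filter.tendsto_id)
      filter_upwards [Filter.eventually_ge_atTop 0] with t ht
      have := sub_le_sub_of_one_le_deriv hF hp ht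
      simp only [id]
      linarith
    · apply Filter.tendsto_atBot_mono' _ _ (Filter.tendsto_atBot_add_const_left _ (F 0)
        Filter.tendsto_id)
      filter_upwards [Filter.eventually_le_atBot 0] with t ht
      have := sub_le_sub_of_one_le_deriv hF hp ht
      simp only [id]
      linarith

lemma lintegral_comp_mul_deriv {F p : ℝ → ℝ} (hF : ∀ t, HasDerivAt F (p t) t)
    (hp : ∀ t, 1 ≤ p t) (u : ℝ → ENNReal) :
    ∫⁻ t, u (F t) * ENNReal.ofReal (p t) = ∫⁻ t, u t := by
  have hb := bijective_of_one_le_deriv hF hp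
  have := lintegral_image_eq_lintegral_abs_deriv_mul (s := Set.univ) (f := F) (f' := p)
    MeasurableSet.univ (fun t _ => (hF t).hasDerivWithinAt) hb.1.injOn u
  rw [Set.image_univ, hb.2.range_eq, Measure.restrict_univ] at this
  rw [this]
  refine lintegral_congr fun t => ?_
  rw [abs_of_nonneg (by linarith [hp t]), mul_comm]

/-- One-dimensional transport: if `F₂ ∘ g = F₁` then `g` transports the derivative of `F₁`
to the derivative of `F₂`. -/
lemma lintegral_comp_of_primitive_eq {F₁ p₁ F₂ p₂ g : ℝ → ℝ}
    (h₁ : ∀ t, HasDerivAt F₁ (p₁ t) t) (hp₁ : ∀ t, 1 ≤ p₁ t)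
    (h₂ : ∀ t, HasDerivAt F₂ (p₂ t) t) (hp₂ : ∀ t, 1 ≤ p₂ t)
    (hg : ∀ t, F₂ (g t) = F₁ t) (u : ℝ → ENNReal) :
    ∫⁻ t, u (g t) * ENNReal.ofReal (p₁ t) = ∫⁻ t, u t * ENNReal.ofReal (p₂ t) := by
  set e := Equiv.ofBijective F₂ (bijective_of_one_le_deriv h₂ hp₂)
  have he : ∀ t, e.symm (F₂ t) = t := fun t => e.symm_apply_apply t
  have e₁ := lintegral_comp_mul_deriv h₁ hp₁ (u ∘ e.symm)
  have e₂ := lintegral_comp_mul_deriv h₂ hp₂ (u ∘ e.symm)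
  simp only [Function.comp, he] at e₁ e₂
  rw [e₂, ← e₁]
  refine lintegral_congr fun t => ?_
  rw [← hg, he]

section Transport

variable {ι : Type*} [DecidableEq ι]

/-- The average of `f` over the segment of length `L` issued from `x` in the `i`-th direction. -/
noncomputable def lineAverage (i : ι) (L : ℝ) (f : (ι → ℝ) → ℝ) (x : ι → ℝ) : ℝ :=
  L⁻¹ * ∫ s in (0 : ℝ)..L, f (x + Pi.single i s)

/-- The integral of `f` over the segment of length `t` issued from `x` in the `i`-th direction. -/
noncomputable def lineIntegral (i : ι) (f : (ι → ℝ) → ℝ) (x : ι → ℝ) (t : ℝ) : ℝ :=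
  ∫ s in (0 : ℝ)..t, f (x + Pi.single i s)

/-- The average of `lineIntegral i f x` over `[t, t + L]`. -/
noncomputable def averagedLineIntegral (i : ι) (L : ℝ) (f : (ι → ℝ) → ℝ) (x : ι → ℝ) (t : ℝ) :
    ℝ :=
  L⁻¹ * ∫ s in (0 : ℝ)..L, lineIntegral i f x (t + s)

lemma continuous_of_abs_sub_le {E : Type*} [NormedAddCommGroup E] {f : E → ℝ} {δ : ℝ}
    (hf : ∀ x y, |f x - f y| ≤ δ * ‖x - y‖) : Continuous f := by
  have : LipschitzWith δ.toNNReal f := by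
    apply LipschitzWith.of_dist_le_mul
    intro x y
    rw [Real.dist_eq, dist_eq_norm]
    exact (hf x y).trans (mul_le_mul_of_nonneg_right (Real.le_coe_toNNReal δ) (norm_nonneg _))
  exact this.continuous

lemma continuous_add_single (i : ι) (x : ι → ℝ) :
    Continuous fun s : ℝ => x + Pi.single i s :=
  continuous_const.add (continuous_single (A := fun _ : ι => ℝ) i)

lemma abs_sub_add_right_le {E : Type*} [NormedAddCommGroup E] {f : E → ℝ} {δ : ℝ}
    (hf : ∀ x y, |f x - f y| ≤ δ * ‖x - y‖) (x y v : E) :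
    |f (x + v) - f (y + v)| ≤ δ * ‖x - y‖ := by
  have := hf (x + v) (y + v)
  rwa [add_sub_add_right_eq_sub] at this

variable {f : (ι → ℝ) → ℝ} (hfc : Continuous f)
include hfc

lemma continuous_line (i : ι) (x : ι → ℝ) :
    Continuous fun s : ℝ => f (x + Pi.single i s) :=
  hfc.comp (continuous_add_single i x)

lemma hasDerivAt_lineIntegral (i : ι) (x : ι → ℝ) (t : ℝ) :
    HasDerivAt (lineIntegral i f x) (f (x + Pi.single i t)) t :=
  intervalIntegral.integral_hasDerivAt_right ((continuous_line hfc i x).intervalIntegrable _ _)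
    ((continuous_line hfc i x).stronglyMeasurableAtFilter _ _)
    (continuous_line hfc i x).continuousAt

lemma continuous_lineIntegral (i : ι) (x : ι → ℝ) : Continuous (lineIntegral i f x) :=
  continuous_iff_continuousAt.2 fun t => (hasDerivAt_lineIntegral hfc i x t).continuousAt

lemma lineIntegral_add (i : ι) (x : ι → ℝ) (h t : ℝ) :
    lineIntegral i f x (h + t) =
      lineIntegral i f x h + lineIntegral i f (x + Pi.single i h) t := by
  unfold lineIntegral
  have := intervalIntegral.integral_add_adjacent_intervals
    ((continuous_line hfc i x).intervalIntegrable (μ := volume) 0 h)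
    ((continuous_line hfc i x).intervalIntegrable h (h + t))
  rw [← this]
  congr 1
  have := intervalIntegral.integral_comp_add_left (a := 0) (b := t)
    (fun s => f (x + Pi.single i s)) h
  rw [add_zero] at this
  rw [← this]
  simp only [Pi.single_add, add_assoc]

lemma averagedLineIntegral_add {L : ℝ} (hL : 0 < L) (i : ι) (x : ι → ℝ) (h t : ℝ) :
    averagedLineIntegral i L f x (h + t) =
      lineIntegral i f x h + averagedLineIntegral i L f (x + Pi.single i h) t := by
  unfold averagedLineIntegral
  simp only [add_assoc, lineIntegral_add hfc i x h]
  rw [intervalIntegral.integral_add]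
  · simp only [intervalIntegral.integral_const, sub_zero, smul_eq_mul]
    field_simp
  · exact intervalIntegrable_const
  · exact ((continuous_lineIntegral hfc i _).comp (continuous_const.add continuous_id)
      ).intervalIntegrable _ _

lemma hasDerivAt_averagedLineIntegral {L : ℝ} (i : ι) (x : ι → ℝ) (t : ℝ) :
    HasDerivAt (averagedLineIntegral i L f x) (lineAverage i L f (x + Pi.single i t)) t := by
  have hF := continuous_lineIntegral hfc i x
  have hd : ∀ a, HasDerivAt (fun t => ∫ s in (0 : ℝ)..t, lineIntegral i f x s)
      (lineIntegral i f x a) a := fun a =>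
    intervalIntegral.integral_hasDerivAt_right (hF.intervalIntegrable _ _)
      (hF.stronglyMeasurableAtFilter _ _) hF.continuousAt
  have heq : averagedLineIntegral i L f x = fun t => L⁻¹ *
      ((∫ s in (0 : ℝ)..(t + L), lineIntegral i f x s) -
        ∫ s in (0 : ℝ)..t, lineIntegral i f x s) := by
    funext t
    unfold averagedLineIntegral
    rw [intervalIntegral.integral_interval_sub_left (hF.intervalIntegrable _ _)
      (hF.intervalIntegrable _ _), intervalIntegral.integral_comp_add_left, add_zero]
  rw [heq]
  have := (((hd (t + L)).comp_add_const t L).sub (hd t)).const_mul L⁻¹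
  rw [lineIntegral_add hfc i x t L, add_sub_cancel_left] at this
  exact this

lemma le_lineAverage {L : ℝ} (hL : 0 < L) (i : ι) {l : ℝ} (hl : ∀ x, l ≤ f x) (x : ι → ℝ) :
    l ≤ lineAverage i L f x := by
  have h := intervalIntegral.integral_mono_on hL.le (intervalIntegrable_const (c := l))
    ((continuous_line hfc i x).intervalIntegrable (μ := volume) 0 L) (fun s _ => hl _)
  simp only [intervalIntegral.integral_const, sub_zero, smul_eq_mul] at h
  unfold lineAverage
  rw [inv_mul_eq_div, le_div_iff₀ hL]
  linarith

lemma lineAverage_le {L : ℝ} (hL : 0 < L) (i : ι) {u : ℝ} (hu : ∀ x, f x ≤ u) (x : ι → ℝ) :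
    lineAverage i L f x ≤ u := by
  have h := intervalIntegral.integral_mono_on hL.le
    ((continuous_line hfc i x).intervalIntegrable (μ := volume) 0 L)
    (intervalIntegrable_const (c := u)) (fun s _ => hu _)
  simp only [intervalIntegral.integral_const, sub_zero, smul_eq_mul] at h
  unfold lineAverage
  rw [inv_mul_eq_div, div_le_iff₀ hL]
  linarith

lemma abs_lineAverage_sub_le {L : ℝ} (hL : 0 < L) (i : ι) {x y : ι → ℝ} {c : ℝ}
    (h : ∀ s : ℝ, |f (x + Pi.single i s) - f (y + Pi.single i s)| ≤ c) :
    |lineAverage i L f x - lineAverage i L f y| ≤ c := by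
  unfold lineAverage
  rw [← mul_sub, ← intervalIntegral.integral_sub ((continuous_line hfc i x).intervalIntegrable _ _)
    ((continuous_line hfc i y).intervalIntegrable _ _), abs_mul, abs_of_pos (inv_pos.2 hL)]
  have := intervalIntegral.norm_integral_le_of_norm_le_const (a := 0) (b := L) (C := c)
    (f := fun s => f (x + Pi.single i s) - f (y + Pi.single i s)) (fun s _ => h s)
  rw [Real.norm_eq_abs, sub_zero, abs_of_pos hL] at this
  rw [inv_mul_le_iff₀ hL]
  linarith

omit hfc

variable [Fintype ι]

lemma abs_lineIntegral_sub_le {δ : ℝ} (hf : ∀ x y, |f x - f y| ≤ δ * ‖x - y‖) (i : ι)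
    (x y : ι → ℝ) (t : ℝ) :
    |lineIntegral i f x t - lineIntegral i f y t| ≤ δ * ‖x - y‖ * |t| := by
  have hfc := continuous_of_abs_sub_le hf
  unfold lineIntegral
  rw [← intervalIntegral.integral_sub ((continuous_line hfc i x).intervalIntegrable _ _)
    ((continuous_line hfc i y).intervalIntegrable _ _)]
  have := intervalIntegral.norm_integral_le_of_norm_le_const (a := 0) (b := t) (C := δ * ‖x - y‖)
    (f := fun s => f (x + Pi.single i s) - f (y + Pi.single i s))
    (fun s _ => abs_sub_add_right_le hf _ _ _)
  simpa using this

lemma abs_averagedLineIntegral_sub_le {δ L : ℝ} (hL : 0 < L)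
    (hf : ∀ x y, |f x - f y| ≤ δ * ‖x - y‖) (i : ι) (x y : ι → ℝ) {t : ℝ}
    (ht : t ∈ Set.Icc (-L) 0) :
    |averagedLineIntegral i L f x t - averagedLineIntegral i L f y t| ≤ L * δ * ‖x - y‖ := by
  have hfc := continuous_of_abs_sub_le hf
  have hint : ∀ x, IntervalIntegrable (fun s => lineIntegral i f x (t + s)) volume 0 L := fun x =>
    ((continuous_lineIntegral hfc i x).comp (continuous_const.add continuous_id)
      ).intervalIntegrable _ _
  have hδ : 0 ≤ δ * ‖x - y‖ := (abs_nonneg _).trans (hf x y)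
  unfold averagedLineIntegral
  rw [← mul_sub, ← intervalIntegral.integral_sub (hint x) (hint y), abs_mul,
    abs_of_pos (inv_pos.2 hL), inv_mul_le_iff₀ hL]
  have := intervalIntegral.norm_integral_le_of_norm_le_const (a := 0) (b := L)
    (C := δ * ‖x - y‖ * L)
    (f := fun s => lineIntegral i f x (t + s) - lineIntegral i f y (t + s)) (fun s hs => by
      rw [Set.uIoc_of_le hL.le] at hs
      refine (abs_lineIntegral_sub_le hf i x y (t + s)).trans ?_
      refine mul_le_mul_of_nonneg_left ?_ hδ
      rw [abs_le]
      constructor <;> linarith [hs.1, hs.2, ht.1, ht.2])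
  rw [Real.norm_eq_abs, sub_zero, abs_of_pos hL] at this
  linarith

omit [Fintype ι] in
lemma averagedLineIntegral_zero_mem {L : ℝ} (hL : 0 < L) (hfc : Continuous f)
    (h1 : ∀ x, 1 ≤ f x) (i : ι) (x : ι → ℝ) :
    averagedLineIntegral i L f x 0 ∈ Set.Icc 0 (lineIntegral i f x L) := by
  have hmono : ∀ s t, s ≤ t → lineIntegral i f x s ≤ lineIntegral i f x t := fun s t hst => by
    have := sub_le_sub_of_one_le_deriv (hasDerivAt_lineIntegral hfc i x) (fun _ => h1 _) hst
    linarith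
  have h0 : lineIntegral i f x 0 = 0 := by simp [lineIntegral]
  have hi := (continuous_lineIntegral hfc i x).intervalIntegrable (μ := volume) 0 L
  have h₁ := intervalIntegral.integral_mono_on hL.le
    (intervalIntegrable_const (c := (0 : ℝ))) hi (fun s hs => h0 ▸ hmono 0 s hs.1)
  have h₂ := intervalIntegral.integral_mono_on hL.le hi
    (intervalIntegrable_const (c := lineIntegral i f x L)) (fun s hs => hmono s L hs.2)
  simp only [intervalIntegral.integral_const, sub_zero, smul_eq_mul, mul_zero] at h₁ h₂
  unfold averagedLineIntegral
  simp only [zero_add]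
  rw [Set.mem_Icc, inv_mul_eq_div, le_div_iff₀ hL, div_le_iff₀ hL]
  constructor <;> linarith

/-- A Lipschitz density is transported to its average along segments by a homeomorphism that is
a Lipschitz perturbation of the identity. -/
theorem exists_transport_lineAverage {δ L : ℝ} (hL : 0 < L)
    (hf : ∀ x y, |f x - f y| ≤ δ * ‖x - y‖) (h1 : ∀ x, 1 ≤ f x) (i : ι) :
    ∃ G : (ι → ℝ) ≃ (ι → ℝ),
      (∀ x y, ‖(G x - x) - (G y - y)‖ ≤ 2 * L * δ * ‖x - y‖) ∧
      (∀ x y, ‖(G.symm x - x) - (G.symm y - y)‖ ≤ 2 * L * δ * ‖x - y‖) ∧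
      ∀ φ : (ι → ℝ) → ENNReal, Measurable φ →
        ∫⁻ x, φ (G x) * ENNReal.ofReal (f x) =
          ∫⁻ x, φ x * ENNReal.ofReal (lineAverage i L f x) := by
  have hfc := continuous_of_abs_sub_le hf
  have h1' : ∀ x, 1 ≤ lineAverage i L f x := le_lineAverage hfc hL i h1
  have hF := hasDerivAt_lineIntegral hfc i
  have hA := fun x => hasDerivAt_averagedLineIntegral hfc (L := L) i x
  have hA0 := averagedLineIntegral_zero_mem hL hfc h1 i
  have hF0 : ∀ x, lineIntegral i f x 0 = 0 := fun x => by simp [lineIntegral]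
  choose h hh using fun x => (bijective_of_one_le_deriv (hA x) (fun t => h1' _)).2 0
  choose k hk using fun x => (bijective_of_one_le_deriv (hF x) (fun t => h1 _)).2
    (averagedLineIntegral i L f x 0)
  have hkmem : ∀ x, k x ∈ Set.Icc 0 L := by
    intro x
    have hm : StrictMono (lineIntegral i f x) := by
      intro s t hst
      have := sub_le_sub_of_one_le_deriv (hF x) (fun t => h1 _) hst.le
      linarith
    have := hA0 x
    rw [← hk, ← hF0 x] at this
    exact ⟨hm.le_iff_le.1 this.1, hm.le_iff_le.1 this.2⟩
  have hinv : ∀ x, k (x + Pi.single i (h x)) = - h x := by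
    intro x
    apply (bijective_of_one_le_deriv (hF (x + Pi.single i (h x))) (fun t => h1 _)).1
    rw [hk]
    have e1 := averagedLineIntegral_add hfc hL i x (h x) 0
    have e2 := lineIntegral_add hfc i x (h x) (- h x)
    rw [add_zero, hh] at e1
    rw [add_neg_cancel, hF0] at e2
    linarith
  have hinv' : ∀ x, h (x + Pi.single i (k x)) = - k x := by
    intro x
    apply (bijective_of_one_le_deriv (hA (x + Pi.single i (k x))) (fun t => h1' _)).1
    rw [hh]
    have e1 := averagedLineIntegral_add hfc hL i x (k x) (- k x)
    rw [add_neg_cancel, hk] at e1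
    linarith
  have hhmem : ∀ x, h x ∈ Set.Icc (-L) 0 := by
    intro x
    have := hkmem (x + Pi.single i (h x))
    rw [hinv] at this
    constructor <;> linarith [this.1, this.2]
  have hδ : ∀ x y, 0 ≤ L * δ * ‖x - y‖ := fun x y => by
    rw [mul_assoc]
    exact mul_nonneg hL.le ((abs_nonneg _).trans (hf x y))
  have hhlip : ∀ x y, |h x - h y| ≤ 2 * L * δ * ‖x - y‖ := by
    intro x y
    have e1 := abs_sub_le_abs_sub_of_one_le_deriv (hA x) (fun t => h1' _) (h x) (h y)
    have e2 := abs_averagedLineIntegral_sub_le hL hf i x y (hhmem y)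
    rw [hh, ← hh y, abs_sub_comm (averagedLineIntegral i L f y (h y))] at e1
    linarith [hδ x y]
  have hklip : ∀ x y, |k x - k y| ≤ 2 * L * δ * ‖x - y‖ := by
    intro x y
    have e1 := abs_sub_le_abs_sub_of_one_le_deriv (hF x) (fun t => h1 _) (k x) (k y)
    have e2 := abs_averagedLineIntegral_sub_le hL hf i x y (t := 0) ⟨by linarith, le_rfl⟩
    have e3 := abs_lineIntegral_sub_le hf i x y (k y)
    have e4 : δ * ‖x - y‖ * |k y| ≤ δ * ‖x - y‖ * L := by
      refine mul_le_mul_of_nonneg_left ?_ ((abs_nonneg _).trans (hf x y))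
      rw [abs_of_nonneg (hkmem y).1]
      exact (hkmem y).2
    have e5 : lineIntegral i f x (k x) - lineIntegral i f x (k y) =
        (averagedLineIntegral i L f x 0 - averagedLineIntegral i L f y 0) -
          (lineIntegral i f x (k y) - lineIntegral i f y (k y)) := by
      rw [hk, hk]; ring
    rw [e5] at e1
    have e6 := abs_sub (averagedLineIntegral i L f x 0 - averagedLineIntegral i L f y 0)
          (lineIntegral i f x (k y) - lineIntegral i f y (k y))
    linarith
  have hsingle : ∀ s : ℝ, ‖(Pi.single i s : ι → ℝ)‖ = |s| := fun s => by
    rw [Pi.norm_single, Real.norm_eq_abs]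
  let G : (ι → ℝ) ≃ (ι → ℝ) :=
    { toFun := fun x => x + Pi.single i (h x)
      invFun := fun x => x + Pi.single i (k x)
      left_inv := fun x => by simp only [hinv, add_assoc, ← Pi.single_add]; simp
      right_inv := fun x => by simp only [hinv', add_assoc, ← Pi.single_add]; simp }
  have hGcont : Continuous G :=
    continuous_id.add ((continuous_single (A := fun _ : ι => ℝ) i).comp
      (continuous_of_abs_sub_le hhlip))
  have hAc : Continuous (lineAverage i L f) := by
    refine continuous_of_abs_sub_le (δ := δ) fun x y => ?_
    exact abs_lineAverage_sub_le hfc hL i fun s => abs_sub_add_right_le hf _ _ _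
  refine ⟨G, fun x y => ?_, fun x y => ?_, fun φ hφ => ?_⟩
  · change ‖(x + Pi.single i (h x) - x) - (y + Pi.single i (h y) - y)‖ ≤ _
    rw [add_sub_cancel_left, add_sub_cancel_left, ← Pi.single_sub, hsingle]
    exact hhlip x y
  · change ‖(x + Pi.single i (k x) - x) - (y + Pi.single i (k y) - y)‖ ≤ _
    rw [add_sub_cancel_left, add_sub_cancel_left, ← Pi.single_sub, hsingle]
    exact hklip x y
  · refine lintegral_eq_of_lmarginal_eq {i} (μ := fun _ => volume)
      ((hφ.comp hGcont.measurable).mul hfc.measurable.ennreal_ofReal)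
      (hφ.mul hAc.measurable.ennreal_ofReal) ?_
    rw [lmarginal_singleton, lmarginal_singleton]
    funext x
    obtain ⟨z, hupd⟩ : ∃ z : ι → ℝ, ∀ t, Function.update x i t = z + Pi.single i t := by
      refine ⟨Function.update x i 0, fun t => ?_⟩
      ext j
      rcases eq_or_ne j i with rfl | hj
      · simp
      · simp [hj]
    simp only [hupd]
    have := lintegral_comp_of_primitive_eq (hF z) (fun t => h1 _) (hA z) (fun t => h1' _)
      (g := fun t => t + h (z + Pi.single i t)) (fun t => by
        rw [averagedLineIntegral_add hfc hL, hh, add_zero])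
      (fun t => φ (z + Pi.single i t))
    rw [← this]
    refine lintegral_congr fun t => ?_
    rw [Pi.single_add, ← add_assoc]
    rfl

end Transport

section Composition

/-- The composition `g (n - 1) ∘ ⋯ ∘ g 0`. -/
def iterComp {E : Type*} (g : ℕ → E ≃ E) : ℕ → (E ≃ E)
  | 0 => Equiv.refl E
  | n + 1 => (iterComp g n).trans (g n)

variable {E : Type*} [NormedAddCommGroup E] {g : ℕ → E ≃ E} {κ : ℕ → ℝ}

lemma norm_sub_le_one_add_mul {G : E → E} {c : ℝ}
    (hG : ∀ x y, ‖(G x - x) - (G y - y)‖ ≤ c * ‖x - y‖) (x y : E) :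
    ‖G x - G y‖ ≤ (1 + c) * ‖x - y‖ := by
  have h : G x - G y = (x - y) + ((G x - x) - (G y - y)) := by abel
  rw [h]
  refine (norm_add_le _ _).trans ?_
  linarith [hG x y]

lemma norm_iterComp_sub_le (hκ : ∀ n, 0 ≤ κ n)
    (hg : ∀ n x y, ‖(g n x - x) - (g n y - y)‖ ≤ κ n * ‖x - y‖) (n : ℕ) (x y : E) :
    ‖iterComp g n x - iterComp g n y‖ ≤ Real.exp (∑ m ∈ Finset.range n, κ m) * ‖x - y‖ := by
  induction n with
  | zero => simp [iterComp]
  | succ n ih =>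
    rw [Finset.sum_range_succ, Real.exp_add]
    have h1 := norm_sub_le_one_add_mul (hg n) (iterComp g n x) (iterComp g n y)
    have h2 : 1 + κ n ≤ Real.exp (κ n) := by linarith [Real.add_one_le_exp (κ n)]
    have h4 := hκ n
    calc _ ≤ (1 + κ n) * ‖iterComp g n x - iterComp g n y‖ := h1
      _ ≤ Real.exp (κ n) * (Real.exp (∑ m ∈ Finset.range n, κ m) * ‖x - y‖) := by gcongr
      _ = _ := by ring

lemma norm_sub_le_iterComp (hκ : ∀ n, 0 ≤ κ n)
    (hg : ∀ n x y, ‖((g n).symm x - x) - ((g n).symm y - y)‖ ≤ κ n * ‖x - y‖)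
    (n : ℕ) (x y : E) :
    ‖x - y‖ ≤ Real.exp (∑ m ∈ Finset.range n, κ m) * ‖iterComp g n x - iterComp g n y‖ := by
  induction n with
  | zero => simp [iterComp]
  | succ n ih =>
    rw [Finset.sum_range_succ, Real.exp_add]
    have h1 := norm_sub_le_one_add_mul (hg n) (iterComp g (n + 1) x) (iterComp g (n + 1) y)
    have h3 : ∀ x, (g n).symm (iterComp g (n + 1) x) = iterComp g n x := fun x => by
      simp [iterComp]
    rw [h3, h3] at h1
    have h2 : 1 + κ n ≤ Real.exp (κ n) := by linarith [Real.add_one_le_exp (κ n)]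
    have h4 := hκ n
    calc _ ≤ _ := ih
      _ ≤ Real.exp (∑ m ∈ Finset.range n, κ m) *
          (Real.exp (κ n) * ‖iterComp g (n + 1) x - iterComp g (n + 1) y‖) := by
        gcongr
        exact h1.trans (by gcongr)
      _ = _ := by ring

/-- If the maps `g n` are perturbations of the identity with summable Lipschitz constants, then
their compositions, normalized to fix the origin, converge to a bi-Lipschitz homeomorphism. -/
theorem exists_limit_iterComp [CompleteSpace E] (hκ : ∀ n, 0 ≤ κ n) (hs : Summable κ)
    (hg : ∀ n x y, ‖(g n x - x) - (g n y - y)‖ ≤ κ n * ‖x - y‖)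
    (hg' : ∀ n x y, ‖((g n).symm x - x) - ((g n).symm y - y)‖ ≤ κ n * ‖x - y‖) :
    ∃ (T : E → E) (K : ℝ) (τ : ℕ → ℝ), 1 ≤ K ∧ Function.Bijective T ∧
      (∀ x y, ‖T x - T y‖ ≤ K * ‖x - y‖ ∧ ‖x - y‖ ≤ K * ‖T x - T y‖) ∧
      (∀ n x y, ‖iterComp g n x - iterComp g n y‖ ≤ K * ‖x - y‖ ∧
        ‖x - y‖ ≤ K * ‖iterComp g n x - iterComp g n y‖) ∧
      Tendsto τ atTop (𝓝 0) ∧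
      ∀ n x, ‖(iterComp g n x - iterComp g n 0) - T x‖ ≤ τ n * ‖x‖ := by
  set K := Real.exp (∑' m, κ m)
  have hK : ∀ n, Real.exp (∑ m ∈ Finset.range n, κ m) ≤ K := fun n =>
    Real.exp_le_exp.2 (hs.sum_le_tsum _ fun m _ => hκ m)
  have hK1 : 1 ≤ K := Real.one_le_exp (tsum_nonneg hκ)
  have hH : ∀ n x y, ‖iterComp g n x - iterComp g n y‖ ≤ K * ‖x - y‖ ∧
        ‖x - y‖ ≤ K * ‖iterComp g n x - iterComp g n y‖ := fun n x y =>
    ⟨(norm_iterComp_sub_le hκ hg n x y).trans (by gcongr; exact hK n),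
      (norm_sub_le_iterComp hκ hg' n x y).trans (by gcongr; exact hK n)⟩
  have hstep : ∀ x n, dist (iterComp g n x - iterComp g n 0)
      (iterComp g (n + 1) x - iterComp g (n + 1) 0) ≤ κ n * (K * ‖x‖) := fun x n => by
    have h1 := hg n (iterComp g n x) (iterComp g n 0)
    have h2 := (hH n x 0).1
    rw [sub_zero] at h2
    rw [dist_comm, dist_eq_norm]
    calc _ = ‖(g n (iterComp g n x) - iterComp g n x) -
            (g n (iterComp g n 0) - iterComp g n 0)‖ := by
          simp only [iterComp, Equiv.trans_apply]
          congr 1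
          abel
      _ ≤ κ n * ‖iterComp g n x - iterComp g n 0‖ := h1
      _ ≤ _ := by gcongr; exact hκ n
  choose T hT using fun x => cauchySeq_tendsto_of_complete
    (cauchySeq_of_dist_le_of_summable _ (hstep x) (hs.mul_right _))
  set τ : ℕ → ℝ := fun n => K * ∑' m, κ (m + n)
  have hτ : Tendsto τ atTop (𝓝 0) := by
    have := (tendsto_sum_nat_add κ).const_mul K
    rwa [mul_zero] at this
  have hTτ : ∀ n x, ‖(iterComp g n x - iterComp g n 0) - T x‖ ≤ τ n * ‖x‖ := fun n x => by
    have := dist_le_tsum_of_dist_le_of_tendsto _ (hstep x) (hs.mul_right _) (hT x) n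
    rw [dist_eq_norm, tsum_mul_right] at this
    calc _ ≤ _ := this
      _ = τ n * ‖x‖ := by
        simp only [τ, add_comm n]
        ring
  have hTK : ∀ x y, ‖T x - T y‖ ≤ K * ‖x - y‖ ∧ ‖x - y‖ ≤ K * ‖T x - T y‖ := fun x y => by
    have hlim := ((hT x).sub (hT y)).norm
    simp only [sub_sub_sub_cancel_right] at hlim
    exact ⟨le_of_tendsto' hlim fun n => (hH n x y).1,
      ge_of_tendsto' (hlim.const_mul K) fun n => (hH n x y).2⟩
  refine ⟨T, K, τ, hK1, ⟨fun x y hxy => ?_, fun y => ?_⟩, hTK, hH, hτ, hTτ⟩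
  · have := (hTK x y).2
    rw [hxy, sub_self, norm_zero, mul_zero] at this
    exact sub_eq_zero.1 (norm_le_zero_iff.1 this)
  · have hlip : LipschitzWith K.toNNReal T := LipschitzWith.of_dist_le_mul fun x y => by
      rw [dist_eq_norm, dist_eq_norm, Real.coe_toNNReal _ (by linarith)]
      exact (hTK x y).1
    have hanti : AntilipschitzWith K.toNNReal T := AntilipschitzWith.of_le_mul_dist fun x y => by
      rw [dist_eq_norm, dist_eq_norm, Real.coe_toNNReal _ (by linarith)]
      exact (hTK x y).2
    have hclosed := hanti.isClosed_range hlip.uniformContinuous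
    set z : ℕ → E := fun n => (iterComp g n).symm (y + iterComp g n 0)
    have hz : ∀ n, iterComp g n (z n) - iterComp g n 0 = y := fun n => by simp [z]
    have hzn : ∀ n, ‖z n‖ ≤ K * ‖y‖ := fun n => by
      have := (hH n (z n) 0).2
      rwa [hz, sub_zero] at this
    have hlim : Tendsto (fun n => T (z n)) atTop (𝓝 y) := by
      rw [tendsto_iff_norm_sub_tendsto_zero]
      have hτ' : Tendsto (fun n => τ n * (K * ‖y‖)) atTop (𝓝 0) := by
        simpa using hτ.mul_const (K * ‖y‖)
      refine squeeze_zero (fun n => norm_nonneg _) (fun n => ?_) hτ'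
      have := hTτ n (z n)
      rw [hz, norm_sub_rev] at this
      refine this.trans (mul_le_mul_of_nonneg_left (hzn n) ?_)
      exact mul_nonneg (by linarith) (tsum_nonneg fun m => hκ _)
    exact hclosed.mem_of_tendsto hlim (Eventually.of_forall fun n => Set.mem_range_self _)

end Composition

section Smoothing

variable {ι : Type*} [Fintype ι] [DecidableEq ι]

omit [Fintype ι] in
lemma lineAverage_neg (i : ι) (L : ℝ) (f : (ι → ℝ) → ℝ) :
    lineAverage i L (fun x => - f x) = fun x => - lineAverage i L f x := by
  funext x
  simp [lineAverage]

lemma abs_lineAverage_sub_le_of_lipschitz {δ L : ℝ} {f : (ι → ℝ) → ℝ} (hL : 0 < L)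
    (hf : ∀ x y, |f x - f y| ≤ δ * ‖x - y‖) (i : ι) (x y : ι → ℝ) :
    |lineAverage i L f x - lineAverage i L f y| ≤ δ * ‖x - y‖ :=
  abs_lineAverage_sub_le (continuous_of_abs_sub_le hf) hL i fun _ => abs_sub_add_right_le hf _ _ _

omit [Fintype ι] in
lemma abs_lineAverage_add_single_sub_le {f : (ι → ℝ) → ℝ} (hfc : Continuous f) {L l u : ℝ}
    (hL : 0 < L) (hl : ∀ x, l ≤ f x) (hu : ∀ x, f x ≤ u) (i : ι) (x : ι → ℝ) (s : ℝ) :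
    |lineAverage i L f (x + Pi.single i s) - lineAverage i L f x| ≤ (u - l) / L * |s| := by
  have e1 := lineIntegral_add hfc i x s L
  have e2 := lineIntegral_add hfc i x L s
  rw [add_comm L s] at e2
  have e3 : lineAverage i L f (x + Pi.single i s) - lineAverage i L f x =
      L⁻¹ * (lineIntegral i f (x + Pi.single i L) s - lineIntegral i f x s) := by
    change L⁻¹ * lineIntegral i f (x + Pi.single i s) L - L⁻¹ * lineIntegral i f x L = _
    rw [← mul_sub]
    congr 1
    linarith
  have e4 : |lineIntegral i f (x + Pi.single i L) s - lineIntegral i f x s| ≤ (u - l) * |s| := by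
    unfold lineIntegral
    rw [← intervalIntegral.integral_sub ((continuous_line hfc i _).intervalIntegrable _ _)
      ((continuous_line hfc i x).intervalIntegrable _ _)]
    have := intervalIntegral.norm_integral_le_of_norm_le_const (a := 0) (b := s) (C := u - l)
      (f := fun t => f (x + Pi.single i L + Pi.single i t) - f (x + Pi.single i t))
      (fun t _ => by
        rw [Real.norm_eq_abs, abs_le]
        constructor <;> linarith [hl (x + Pi.single i L + Pi.single i t),
          hu (x + Pi.single i L + Pi.single i t), hl (x + Pi.single i t), hu (x + Pi.single i t)])
    rwa [Real.norm_eq_abs, sub_zero] at this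
  rw [e3, abs_mul, abs_of_pos (inv_pos.2 hL), div_mul_eq_mul_div, inv_mul_eq_div]
  gcongr

omit [Fintype ι] in
lemma abs_lineAverage_add_single_sub_le_of_forall {f : (ι → ℝ) → ℝ} (hfc : Continuous f)
    {L δ : ℝ} (hL : 0 < L) {i : ι} (hf : ∀ x s, |f (x + Pi.single i s) - f x| ≤ δ * |s|) (j : ι)
    (x : ι → ℝ) (s : ℝ) :
    |lineAverage j L f (x + Pi.single i s) - lineAverage j L f x| ≤ δ * |s| :=
  abs_lineAverage_sub_le hfc hL j fun t => by
    rw [add_right_comm]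
    exact hf _ s

lemma abs_sub_le_of_forall_single {f : (ι → ℝ) → ℝ} {δ : ℝ} (hδ : 0 ≤ δ)
    (hf : ∀ i x s, |f (x + Pi.single i s) - f x| ≤ δ * |s|) (x y : ι → ℝ) :
    |f x - f y| ≤ Fintype.card ι * δ * ‖x - y‖ := by
  have key : ∀ S : Finset ι, |f (S.piecewise x y) - f y| ≤ S.card * δ * ‖x - y‖ := by
    intro S
    induction S using Finset.induction_on with
    | empty => simp
    | insert i S hi ih =>
      have h1 : (insert i S).piecewise x y =
          S.piecewise x y + Pi.single i (x i - y i) := by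
        rw [Finset.piecewise_insert]
        ext j
        rcases eq_or_ne j i with rfl | hj
        · simp [hi]
        · simp [hj]
      have h2 := hf i (S.piecewise x y) (x i - y i)
      rw [← h1] at h2
      have h3 : |x i - y i| ≤ ‖x - y‖ := norm_le_pi_norm (x - y) i
      have h4 : δ * |x i - y i| ≤ δ * ‖x - y‖ := by gcongr
      have h5 := abs_sub_le (f ((insert i S).piecewise x y)) (f (S.piecewise x y)) (f y)
      rw [Finset.card_insert_of_notMem hi]
      push_cast
      linarith
  simpa using key Finset.univ

/-- Averages of a function which is smaller on a subinterval. -/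
lemma inv_mul_integral_le {p : ℝ → ℝ} (hp : Continuous p) {L b η u v : ℝ} (hL : 0 < L)
    (hb : 0 ≤ b) (hη : 0 ≤ η) (hbL : b + η ≤ L) (hu : ∀ s, p s ≤ u)
    (hv : ∀ s ∈ Set.Icc b (b + η), p s ≤ v) :
    L⁻¹ * ∫ s in (0 : ℝ)..L, p s ≤ u - (u - v) * (η / L) := by
  have hi : ∀ a c, IntervalIntegrable p volume a c := fun a c => hp.intervalIntegrable a c
  rw [← intervalIntegral.integral_add_adjacent_intervals (hi 0 b) (hi b L),
    ← intervalIntegral.integral_add_adjacent_intervals (hi b (b + η)) (hi (b + η) L)]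
  have h1 := intervalIntegral.integral_mono_on hb (hi 0 b)
    (intervalIntegrable_const (c := u)) (fun s _ => hu s)
  have h2 := intervalIntegral.integral_mono_on (by linarith) (hi b (b + η))
    (intervalIntegrable_const (c := v)) hv
  have h3 := intervalIntegral.integral_mono_on hbL (hi (b + η) L)
    (intervalIntegrable_const (c := u)) (fun s _ => hu s)
  simp only [intervalIntegral.integral_const, sub_zero, smul_eq_mul] at h1 h2 h3
  have h4 : u - (u - v) * (η / L) = (u * L - (u - v) * η) / L := by field_simp
  rw [h4, inv_mul_eq_div]
  gcongr
  linarith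

end Smoothing

section Stage

variable {d : ℕ} [NeZero d] {e : ℕ → (Fin d → ℝ) → ℝ} {L : ℝ}

lemma ofNat_eq {j : ℕ} (hj : j < d) : Fin.ofNat d j = ⟨j, hj⟩ := by
  ext
  simp [Nat.mod_eq_of_lt hj]

/-- Averaging successively in all coordinate directions turns a function of small oscillation into
a function with small Lipschitz constant. -/
lemma abs_sub_le_of_lineAverage_all (hL : 0 < L) (hc : ∀ j, Continuous (e j))
    (he : ∀ j < d, e (j + 1) = lineAverage (Fin.ofNat d j) L (e j)) {l u : ℝ}
    (hl : ∀ j x, l ≤ e j x) (hu : ∀ j x, e j x ≤ u) (x y : Fin d → ℝ) :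
    |e d x - e d y| ≤ d * ((u - l) / L) * ‖x - y‖ := by
  have key : ∀ j ≤ d, ∀ i : Fin d, (i : ℕ) < j → ∀ x s,
      |e j (x + Pi.single i s) - e j x| ≤ (u - l) / L * |s| := by
    intro j
    induction j with
    | zero => intro _ i hi; exact absurd hi (Nat.not_lt_zero _)
    | succ j ih =>
      intro hj i hi x s
      rw [he j hj]
      rcases Nat.lt_succ_iff_lt_or_eq.1 hi with h | h
      · exact abs_lineAverage_add_single_sub_le_of_forall (hc j) hL (ih (by omega) i h) _ x s
      · have : Fin.ofNat d j = i := by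
          rw [ofNat_eq hj]; ext; exact h.symm
        rw [this]
        exact abs_lineAverage_add_single_sub_le (hc j) hL (hl j) (hu j) i x s
  have hlu : 0 ≤ (u - l) / L := div_nonneg (by linarith [hl 0 0, hu 0 0]) hL.le
  simpa using abs_sub_le_of_forall_single hlu (fun i => key d le_rfl i i.2) x y

/-- A function bounded by `w` on a box has averages over larger boxes bounded away from its
supremum. -/
lemma lineAverage_all_le (hL : 0 < L) (hc : ∀ j, Continuous (e j))
    (he : ∀ j < d, e (j + 1) = lineAverage (Fin.ofNat d j) L (e j)) {u w η : ℝ} (hη : 0 ≤ η)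
    (hu : ∀ j x, e j x ≤ u) {a : Fin d → ℝ}
    (hw : ∀ x, (∀ i, x i ∈ Set.Icc (a i) (a i + η)) → e 0 x ≤ w) {y : Fin d → ℝ}
    (hy : ∀ i, y i ≤ a i ∧ a i + η ≤ y i + L) :
    e d y ≤ u - (u - w) * (η / L) ^ d := by
  have key : ∀ j ≤ d, ∀ y : Fin d → ℝ,
      (∀ i : Fin d, (i : ℕ) < j → y i ≤ a i ∧ a i + η ≤ y i + L) →
      (∀ i : Fin d, j ≤ (i : ℕ) → y i ∈ Set.Icc (a i) (a i + η)) →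
      e j y ≤ u - (u - w) * (η / L) ^ j := by
    intro j
    induction j with
    | zero =>
      intro _ y _ h2
      simpa using hw y fun i => h2 i (Nat.zero_le _)
    | succ j ih =>
      intro hj y h1 h2
      rw [he j hj, ofNat_eq hj]
      set i₀ : Fin d := ⟨j, hj⟩
      have hi₀ := h1 i₀ (Nat.lt_succ_self j)
      have := inv_mul_integral_le (continuous_line (hc j) i₀ y) hL (b := a i₀ - y i₀) (η := η)
        (u := u) (v := u - (u - w) * (η / L) ^ j) (by linarith) hη (by linarith)
        (fun s => hu j _) (fun s hs => by
          apply ih (by omega)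
          · intro i hi
            have hne : i ≠ i₀ := fun h => by simp [h, i₀] at hi
            simpa [hne] using h1 i (by omega)
          · intro i hi
            rcases eq_or_ne i i₀ with rfl | hne
            · simp only [Pi.add_apply, Pi.single_eq_same]
              constructor <;> linarith [hs.1, hs.2]
            · have : (i : ℕ) ≠ j := fun h => hne (Fin.ext h)
              simpa [hne] using h2 i (by omega))
      refine this.trans (le_of_eq ?_)
      ring
  exact key d le_rfl y (fun i _ => hy i) (fun i hi => absurd i.2 (by omega))

end Stage

section Locality

variable {ι : Type*} [Fintype ι] [DecidableEq ι]

/-- The patches of radius `r` of `D` around `x` and `x + t` are translates of each other. -/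
def SamePatch {E : Type*} [NormedAddCommGroup E] (D : Set E) (r : ℝ) (x t : E) : Prop :=
  ∀ p, ‖p - x‖ ≤ r → (p ∈ D ↔ p + t ∈ D)

/-- The value of `f` at a point is determined by the patch of radius `r` of `D` around it. -/
def IsLocalFunction {E : Type*} [NormedAddCommGroup E] (D : Set E) (r : ℝ) (f : E → ℝ) : Prop :=
  ∀ x t, SamePatch D r x t → f (x + t) = f x

lemma IsLocalFunction.mono {E : Type*} [NormedAddCommGroup E] {D : Set E} {r r' : ℝ} {f : E → ℝ}
    (hf : IsLocalFunction D r f) (h : r ≤ r') : IsLocalFunction D r' f :=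
  fun x t ht => hf x t fun p hp => ht p (hp.trans h)

lemma IsLocalFunction.lineAverage {D : Set (ι → ℝ)} {r L : ℝ} {f : (ι → ℝ) → ℝ} (hL : 0 ≤ L)
    (hf : IsLocalFunction D r f) (i : ι) : IsLocalFunction D (r + L) (lineAverage i L f) := by
  intro x t hxt
  unfold _root_.lineAverage
  congr 1
  refine intervalIntegral.integral_congr fun s hs => ?_
  rw [Set.uIcc_of_le hL] at hs
  rw [add_right_comm]
  refine hf _ _ fun p hp => hxt p ?_
  have h1 : p - x = (p - (x + Pi.single i s)) + Pi.single i s := by abel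
  have h2 : ‖(Pi.single i s : ι → ℝ)‖ = |s| := by rw [Pi.norm_single, Real.norm_eq_abs]
  rw [h1]
  refine (norm_add_le _ _).trans ?_
  rw [h2, abs_of_nonneg hs.1]
  exact add_le_add hp hs.2

end Locality

section Smoothing

variable {d : ℕ} [NeZero d]

/-- Successive averages of `f` over segments in the coordinate directions, taken cyclically; the
lengths of the segments are multiplied by `Λ` after each cycle. -/
noncomputable def smoothing (Λ : ℝ) (f : (Fin d → ℝ) → ℝ) : ℕ → (Fin d → ℝ) → ℝ
  | 0 => f
  | n + 1 => lineAverage (Fin.ofNat d n) (Λ ^ (n / d)) (smoothing Λ f n)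

variable {Λ : ℝ} {f : (Fin d → ℝ) → ℝ}

lemma smoothing_stage (k : ℕ) {j : ℕ} (hj : j < d) :
    smoothing Λ f (k * d + j + 1) =
      lineAverage (Fin.ofNat d j) (Λ ^ k) (smoothing Λ f (k * d + j)) := by
  have h1 : (k * d + j) / d = k := by
    rw [mul_comm, Nat.mul_add_div (Nat.pos_of_neZero d), Nat.div_eq_of_lt hj, add_zero]
  have h2 : Fin.ofNat d (k * d + j) = Fin.ofNat d j := by
    ext
    simp
  rw [smoothing, h1, h2]

lemma abs_smoothing_sub_le (hΛ : 0 < Λ) {δ : ℝ} {n m : ℕ} (hnm : n ≤ m)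
    (h : ∀ x y, |smoothing Λ f n x - smoothing Λ f n y| ≤ δ * ‖x - y‖) (x y : Fin d → ℝ) :
    |smoothing Λ f m x - smoothing Λ f m y| ≤ δ * ‖x - y‖ := by
  induction m, hnm using Nat.le_induction generalizing x y with
  | base => exact h x y
  | succ m _ ih => exact abs_lineAverage_sub_le_of_lipschitz (pow_pos hΛ _) ih _ x y

lemma le_smoothing (hΛ : 0 < Λ) (hc : ∀ n, Continuous (smoothing Λ f n)) {l : ℝ} {n m : ℕ}
    (hnm : n ≤ m) (h : ∀ x, l ≤ smoothing Λ f n x) (x : Fin d → ℝ) : l ≤ smoothing Λ f m x := by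
  induction m, hnm using Nat.le_induction generalizing x with
  | base => exact h x
  | succ m _ ih => exact le_lineAverage (hc m) (pow_pos hΛ _) _ ih x

lemma smoothing_le (hΛ : 0 < Λ) (hc : ∀ n, Continuous (smoothing Λ f n)) {u : ℝ} {n m : ℕ}
    (hnm : n ≤ m) (h : ∀ x, smoothing Λ f n x ≤ u) (x : Fin d → ℝ) : smoothing Λ f m x ≤ u := by
  induction m, hnm using Nat.le_induction generalizing x with
  | base => exact h x
  | succ m _ ih => exact lineAverage_le (hc m) (pow_pos hΛ _) _ ih x

lemma isLocalFunction_smoothing_stage (hΛ : 0 < Λ) {D : Set (Fin d → ℝ)} {r : ℝ} (k : ℕ)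
    (h : IsLocalFunction D r (smoothing Λ f (k * d))) {j : ℕ} (hj : j ≤ d) :
    IsLocalFunction D (r + j * Λ ^ k) (smoothing Λ f (k * d + j)) := by
  induction j with
  | zero => simpa using h
  | succ j ih =>
    rw [← add_assoc, smoothing_stage k hj]
    have := (ih (by omega)).lineAverage (pow_nonneg hΛ.le k) (Fin.ofNat d j)
    refine this.mono (le_of_eq ?_)
    push_cast
    ring

lemma isLocalFunction_smoothing (hΛ : 2 ≤ Λ) {D : Set (Fin d → ℝ)} {W : ℝ}
    (h : IsLocalFunction D W f) (k : ℕ) :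
    IsLocalFunction D (W + 2 * d * Λ ^ k) (smoothing Λ f ((k + 1) * d)) := by
  have hd : (0 : ℝ) ≤ d := Nat.cast_nonneg d
  induction k with
  | zero =>
    have := isLocalFunction_smoothing_stage (f := f) (Λ := Λ) (by linarith) 0 (r := W) (D := D)
      (by simpa [smoothing] using h) (le_refl d)
    rw [zero_add, one_mul]
    rw [zero_mul, zero_add] at this
    refine this.mono ?_
    simp only [pow_zero]
    linarith
  | succ k ih =>
    have := isLocalFunction_smoothing_stage (by linarith) (k + 1) ih (le_refl d)
    rw [add_mul (k + 1) 1 d, one_mul]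
    refine this.mono ?_
    have h1 : 0 ≤ d * Λ ^ k := mul_nonneg hd (pow_nonneg (by linarith) k)
    rw [pow_succ]
    nlinarith

lemma abs_smoothing_sub_le_of_mem (hΛ : 0 < Λ) (hc : ∀ n, Continuous (smoothing Λ f n)) (k : ℕ)
    {l u : ℝ} (hl : ∀ x, l ≤ smoothing Λ f (k * d) x) (hu : ∀ x, smoothing Λ f (k * d) x ≤ u)
    (x y : Fin d → ℝ) :
    |smoothing Λ f ((k + 1) * d) x - smoothing Λ f ((k + 1) * d) y| ≤
      d * ((u - l) / Λ ^ k) * ‖x - y‖ := by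
  have := abs_sub_le_of_lineAverage_all (e := fun j => smoothing Λ f (k * d + j)) (pow_pos hΛ k)
    (fun j => hc _) (fun j hj => smoothing_stage k hj)
    (fun j => le_smoothing hΛ hc (Nat.le_add_right _ _) hl)
    (fun j => smoothing_le hΛ hc (Nat.le_add_right _ _) hu) x y
  rw [add_mul k 1 d, one_mul]
  exact this

/-- Every patch of radius `r ≥ 1` of `D` has a translate within distance `C * r` of every
point. -/
def PatchRepetitive {E : Type*} [NormedAddCommGroup E] (D : Set E) (C : ℝ) : Prop :=
  ∀ r, 1 ≤ r → ∀ x y, ∃ t, ‖x + t - y‖ ≤ C * r ∧ SamePatch D r x t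

lemma smoothing_contraction {D : Set (Fin d → ℝ)} {C W : ℝ} (hC : 1 ≤ C) (hW : 1 ≤ W)
    (hD : PatchRepetitive D C) (hf : IsLocalFunction D W f) (hΛ : Λ = 4 * C * (W + 2 * d))
    (hc : ∀ n, Continuous (smoothing Λ f n)) (k : ℕ) {l u : ℝ}
    (hl : ∀ x, l ≤ smoothing Λ f (k * d) x) (hu : ∀ x, smoothing Λ f (k * d) x ≤ u) :
    ∃ l' u', u' - l' ≤ (1 - 3 / 4 * (1 / (8 * d * Λ)) ^ d) * (u - l) ∧
      (∀ x, l' ≤ smoothing Λ f ((k + 2) * d) x) ∧ ∀ x, smoothing Λ f ((k + 2) * d) x ≤ u' := by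
  have hd : (1 : ℝ) ≤ d := by exact_mod_cast Nat.pos_of_neZero d
  have hΛ2 : 2 ≤ Λ := by rw [hΛ]; nlinarith
  have hΛ0 : 0 < Λ := by linarith
  have hk0 : 0 < Λ ^ k := pow_pos hΛ0 k
  have hk1 : 1 ≤ Λ ^ k := one_le_pow₀ (by linarith)
  set g := smoothing Λ f ((k + 1) * d)
  set v := g 0
  set η : ℝ := Λ ^ k / (8 * d)
  set L := Λ ^ (k + 1)
  have hL : 0 < L := pow_pos hΛ0 _
  have hη0 : 0 ≤ η := by positivity
  have hηL : η / L = 1 / (8 * d * Λ) := by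
    simp only [η, L, pow_succ]
    field_simp
  have hη4 : η ≤ L / 4 := by
    have h1 : η ≤ Λ ^ k := div_le_self hk0.le (by linarith)
    have h2 : η ≤ Λ ^ k / 8 := by
      simp only [η]
      gcongr
      linarith
    simp only [L, pow_succ]
    nlinarith
  have hstep : ∀ y : Fin d → ℝ, ∃ a : Fin d → ℝ, (∀ i, y i ≤ a i ∧ a i + η ≤ y i + L) ∧
      ∀ x, (∀ i, x i ∈ Set.Icc (a i) (a i + η)) → |g x - v| ≤ (u - l) / 8 := by
    intro y
    obtain ⟨t, ht, hp⟩ := hD (W + 2 * d * Λ ^ k) (by nlinarith) 0 (y + fun _ => L / 2)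
    rw [zero_add] at ht
    have ht4 : ‖t - (y + fun _ => L / 2)‖ ≤ L / 4 := by
      refine ht.trans ?_
      simp only [L, pow_succ]
      rw [hΛ] at hk1 hk0 ⊢
      nlinarith [mul_nonneg (mul_nonneg (by linarith : (0 : ℝ) ≤ C) (by linarith : (0 : ℝ) ≤ W))
        (by linarith : (0 : ℝ) ≤ (4 * C * (W + 2 * d)) ^ k - 1)]
    refine ⟨t, fun i => ?_, fun x hx => ?_⟩
    · have h1 := (norm_le_pi_norm (t - (y + fun _ => L / 2)) i).trans ht4
      rw [Real.norm_eq_abs, abs_le] at h1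
      simp only [Pi.sub_apply, Pi.add_apply] at h1
      constructor <;> linarith [h1.1, h1.2]
    · have h1 : g t = v := by
        have := isLocalFunction_smoothing hΛ2 hf k 0 t hp
        rwa [zero_add] at this
      have h2 := abs_smoothing_sub_le_of_mem hΛ0 hc k hl hu x t
      have h3 : ‖x - t‖ ≤ η := by
        rw [pi_norm_le_iff_of_nonneg hη0]
        intro i
        rw [Real.norm_eq_abs, Pi.sub_apply, abs_le]
        constructor <;> linarith [(hx i).1, (hx i).2]
      have h0 : 0 ≤ u - l := by linarith [hl 0, hu 0]
      rw [← h1]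
      refine h2.trans ?_
      calc _ ≤ d * ((u - l) / Λ ^ k) * η := by gcongr
        _ = (u - l) / 8 := by
          simp only [η]
          field_simp
  have hl1 := le_smoothing hΛ0 hc (Nat.mul_le_mul_right d (Nat.le_succ k)) hl
  have hu1 := smoothing_le hΛ0 hc (Nat.mul_le_mul_right d (Nat.le_succ k)) hu
  have hd2 : (k + 2) * d = (k + 1) * d + d := by ring
  set c := (1 / (8 * (d : ℝ) * Λ)) ^ d
  refine ⟨l + (v - (u - l) / 8 - l) * c, u - (u - (v + (u - l) / 8)) * c, le_of_eq (by ring),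
    fun y => ?_, fun y => ?_⟩
  · obtain ⟨a, ha, hav⟩ := hstep y
    have := lineAverage_all_le (e := fun j x => - smoothing Λ f ((k + 1) * d + j) x)
      (L := L) (u := -l) (w := -(v - (u - l) / 8)) (η := η) (a := a) (y := y) hL
      (fun j => (hc _).neg) (fun j hj => by
        rw [lineAverage_neg, ← smoothing_stage (k + 1) hj]
        rfl) hη0
      (fun j x => neg_le_neg (le_smoothing hΛ0 hc (Nat.le_add_right _ _) hl1 x))
      (fun x hx => by
        have := abs_le.1 (hav x hx)
        simp only [add_zero]
        linarith [this.1]) ha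
    rw [hηL] at this
    rw [hd2]
    linarith
  · obtain ⟨a, ha, hav⟩ := hstep y
    have := lineAverage_all_le (e := fun j => smoothing Λ f ((k + 1) * d + j))
      (L := L) (u := u) (w := v + (u - l) / 8) (η := η) (a := a) (y := y) hL
      (fun j => hc _) (fun j hj => smoothing_stage (k + 1) hj) hη0
      (fun j => smoothing_le hΛ0 hc (Nat.le_add_right _ _) hu1)
      (fun x hx => by
        have := abs_le.1 (hav x hx)
        simp only [add_zero]
        linarith [this.2]) ha
    rw [hηL] at this
    rw [hd2]
    exact this

lemma summable_pow_div {θ : ℝ} (h0 : 0 < θ) (h1 : θ < 1) :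
    Summable fun n : ℕ => θ ^ ((n / d - 1) / 2) := by
  have hd : 0 < d := Nat.pos_of_neZero d
  set s : ℝ := θ ^ ((2 * d : ℕ) : ℝ)⁻¹
  have hs : s ^ (2 * d) = θ := Real.rpow_inv_natCast_pow h0.le (by omega)
  have hs0 : 0 ≤ s := Real.rpow_nonneg h0.le _
  have hs1 : s < 1 := Real.rpow_lt_one h0.le h1 (by positivity)
  have hsum : Summable fun n : ℕ => s ^ (n - 3 * d) := by
    rw [← summable_nat_add_iff (3 * d)]
    simpa using summable_geometric_of_lt_one hs0 hs1
  refine Summable.of_nonneg_of_le (fun n => by positivity) (fun n => ?_) hsum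
  rw [← hs, ← pow_mul]
  refine pow_le_pow_of_le_one hs0 hs1.le ?_
  have e1 := Nat.div_add_mod n d
  have e2 := Nat.mod_lt n hd
  have e3 : n / d ≤ 2 * ((n / d - 1) / 2) + 2 := by omega
  have e4 := Nat.mul_le_mul_left d e3
  have e5 : d * (2 * ((n / d - 1) / 2) + 2) = 2 * d * ((n / d - 1) / 2) + 2 * d := by ring
  omega

/-- The smoothed densities of a linearly repetitive set converge geometrically to a constant. -/
theorem exists_smoothing_limit {D : Set (Fin d → ℝ)} {C W δ₀ u₀ : ℝ} (hC : 1 ≤ C) (hW : 1 ≤ W)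
    (hD : PatchRepetitive D C) (hf : IsLocalFunction D W f)
    (hlip : ∀ x y, |f x - f y| ≤ δ₀ * ‖x - y‖) (hf1 : ∀ x, 1 ≤ f x) (hfu : ∀ x, f x ≤ u₀) :
    ∃ (Λ ρ : ℝ) (δ ω : ℕ → ℝ), 0 < Λ ∧ 1 ≤ ρ ∧ (∀ n, 0 ≤ δ n) ∧
      (∀ n x y, |smoothing Λ f n x - smoothing Λ f n y| ≤ δ n * ‖x - y‖) ∧
      Summable (fun n => Λ ^ (n / d) * δ n) ∧ Tendsto ω atTop (𝓝 0) ∧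
      (∀ n x, |smoothing Λ f n x - ρ| ≤ ω n) ∧ ∀ n x, 1 ≤ smoothing Λ f n x := by
  have hd : (1 : ℝ) ≤ d := by exact_mod_cast Nat.pos_of_neZero d
  set Λ := 4 * C * (W + 2 * d) with hΛ
  have hΛ2 : 2 ≤ Λ := by rw [hΛ]; nlinarith
  have hΛ0 : 0 < Λ := by linarith
  have hc : ∀ n, Continuous (smoothing Λ f n) := fun n =>
    continuous_of_abs_sub_le (abs_smoothing_sub_le hΛ0 (Nat.zero_le n) hlip)
  set θ := 1 - 3 / 4 * (1 / (8 * d * Λ)) ^ d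
  have hc0 : 0 < (1 / (8 * d * Λ)) ^ d := by positivity
  have hc1 : (1 / (8 * d * Λ)) ^ d ≤ 1 := by
    refine pow_le_one₀ (by positivity) ?_
    rw [div_le_one (by positivity)]
    nlinarith
  have hθ0 : 0 < θ := by simp only [θ]; linarith
  have hθ1 : θ < 1 := by simp only [θ]; linarith
  set o := u₀ - 1
  have ho : 0 ≤ o := by simp only [o]; linarith [hf1 0, hfu 0]
  have hI : ∀ k : ℕ, ∃ l u, u - l ≤ o * θ ^ k ∧ (∀ x, l ≤ smoothing Λ f (2 * k * d) x) ∧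
      ∀ x, smoothing Λ f (2 * k * d) x ≤ u := by
    intro k
    induction k with
    | zero => exact ⟨1, u₀, by simp [o], by simpa [smoothing] using hf1,
        by simpa [smoothing] using hfu⟩
    | succ k ih =>
      obtain ⟨l, u, hlu, hl, hu⟩ := ih
      obtain ⟨l', u', hlu', hl', hu'⟩ := smoothing_contraction hC hW hD hf hΛ hc (2 * k) hl hu
      refine ⟨l', u', hlu'.trans ?_, hl', hu'⟩
      rw [pow_succ]
      calc _ ≤ θ * (o * θ ^ k) := by gcongr
        _ = _ := by ring
  set b : ℕ → ℝ := fun n => θ ^ ((n / d - 1) / 2)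
  have hbs : Summable b := summable_pow_div hθ0 hθ1
  have hb0 : Tendsto (fun n => o * b n) atTop (𝓝 0) := by
    simpa using hbs.tendsto_atTop_zero.const_mul o
  have hdiv : ∀ n, n / d * d ≤ n := fun n => Nat.div_mul_le_self n d
  have hosc : ∀ n m, n ≤ m → ∀ x y, |smoothing Λ f n x - smoothing Λ f m y| ≤ o * b n := by
    intro n m hnm x y
    obtain ⟨l, u, hlu, hl, hu⟩ := hI ((n / d - 1) / 2)
    have hn : 2 * ((n / d - 1) / 2) * d ≤ n :=
      (Nat.mul_le_mul_right d ((Nat.mul_div_le _ 2).trans (Nat.sub_le _ _))).trans (hdiv n)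
    rw [abs_le]
    have h1 := le_smoothing hΛ0 hc hn hl x
    have h2 := smoothing_le hΛ0 hc hn hu x
    have h3 := le_smoothing hΛ0 hc (hn.trans hnm) hl y
    have h4 := smoothing_le hΛ0 hc (hn.trans hnm) hu y
    constructor <;> linarith
  obtain ⟨ρ, hρ⟩ := cauchySeq_tendsto_of_complete (cauchySeq_of_le_tendsto_0'
    (s := fun n => smoothing Λ f n 0) (fun n => o * b n)
    (fun n m hnm => by rw [Real.dist_eq]; exact hosc n m hnm 0 0) hb0)
  have h1 : ∀ n x, 1 ≤ smoothing Λ f n x := fun n => le_smoothing hΛ0 hc (Nat.zero_le n) hf1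
  have hδ₀ : 0 ≤ max δ₀ (d * Λ * o) := le_max_of_le_right (by positivity)
  refine ⟨Λ, ρ, fun n => max δ₀ (d * Λ * o) * b n / Λ ^ (n / d), fun n => o * b n, hΛ0,
    ge_of_tendsto' hρ fun n => h1 n 0, fun n => by positivity, fun n x y => ?_, ?_, hb0,
    fun n x => ?_, h1⟩
  · rcases Nat.eq_zero_or_pos (n / d) with h0 | hpos
    · simp only [b, h0, pow_zero, div_one, Nat.zero_sub, Nat.zero_div, mul_one]
      refine (abs_smoothing_sub_le hΛ0 (Nat.zero_le n) hlip x y).trans ?_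
      gcongr
      exact le_max_left _ _
    · obtain ⟨q, hq⟩ : ∃ q, n / d = q + 1 := ⟨n / d - 1, by omega⟩
      obtain ⟨l, u, hlu, hl, hu⟩ := hI (q / 2)
      have hq2 : 2 * (q / 2) * d ≤ q * d := Nat.mul_le_mul_right d (by omega)
      have hn : (q + 1) * d ≤ n := by rw [← hq]; exact hdiv n
      have := abs_smoothing_sub_le hΛ0 hn (abs_smoothing_sub_le_of_mem hΛ0 hc q
        (le_smoothing hΛ0 hc hq2 hl) (smoothing_le hΛ0 hc hq2 hu)) x y
      refine this.trans ?_
      gcongr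
      simp only [b, hq, Nat.add_sub_cancel, pow_succ]
      calc (d : ℝ) * ((u - l) / Λ ^ q) ≤ d * (o * θ ^ (q / 2) / Λ ^ q) := by gcongr
        _ = (d * Λ * o) * θ ^ (q / 2) / (Λ ^ q * Λ) := by field_simp
        _ ≤ _ := by
          gcongr
          exact le_max_right _ _
  · have : (fun n => Λ ^ (n / d) * (max δ₀ (d * Λ * o) * b n / Λ ^ (n / d))) =
        fun n => max δ₀ (d * Λ * o) * b n := by
      funext n
      field_simp
    rw [this]
    exact hbs.mul_left _
  · exact le_of_tendsto ((tendsto_const_nhds.sub hρ).abs) (by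
      filter_upwards [eventually_ge_atTop n] with m hm
      exact hosc n m hm x 0)

end Smoothing

section TentDensity

variable {E : Type*} [NormedAddCommGroup E]

/-- The tent function of radius `W` centred at `p`. -/
noncomputable def tent (W : ℝ) (p x : E) : ℝ := max 0 (W - ‖x - p‖)

/-- The sum of the tent functions of radius `W` centred at the points of `D`. -/
noncomputable def tentDensity (D : Set E) (W : ℝ) (x : E) : ℝ := ∑' p : D, tent W (p : E) x

lemma tent_nonneg (W : ℝ) (p x : E) : 0 ≤ tent W p x := le_max_left _ _

lemma tent_eq_zero {W : ℝ} {p x : E} (h : W < ‖x - p‖) : tent W p x = 0 :=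
  max_eq_left (by linarith)

lemma tent_le {W : ℝ} (hW : 0 ≤ W) (p x : E) : tent W p x ≤ W :=
  max_le hW (by linarith [norm_nonneg (x - p)])

lemma abs_tent_sub_le (W : ℝ) (p x y : E) : |tent W p x - tent W p y| ≤ ‖x - y‖ := by
  have h1 := abs_max_sub_max_le_abs (W - ‖x - p‖) (W - ‖y - p‖) 0
  have h2 := abs_norm_sub_norm_le (x - p) (y - p)
  rw [sub_sub_sub_cancel_right] at h2
  rw [sub_sub_sub_cancel_left, abs_sub_comm ‖y - p‖] at h1
  unfold tent
  rw [max_comm 0, max_comm 0]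
  exact h1.trans h2

lemma continuous_tent (W : ℝ) (p : E) : Continuous (tent W p) :=
  continuous_of_abs_sub_le (δ := 1) fun x y => by simpa using abs_tent_sub_le W p x y

variable {D : Set E} {W : ℝ}

/-- The points of `D` within distance `W` of `x`. -/
noncomputable def nearPoints (hD : ∀ x r, (D ∩ Metric.closedBall x r).Finite) (W : ℝ) (x : E) :
    Finset D :=
  ((hD x W).preimage Subtype.val_injective.injOn).toFinset

variable (hD : ∀ x r, (D ∩ Metric.closedBall x r).Finite)
include hD

lemma mem_nearPoints {x : E} {p : D} : p ∈ nearPoints hD W x ↔ ‖x - p‖ ≤ W := by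
  simp [nearPoints, dist_eq_norm, norm_sub_rev]

lemma tent_eq_zero_of_notMem {x : E} {p : D} (hp : p ∉ nearPoints hD W x) :
    tent W (p : E) x = 0 := by
  rw [mem_nearPoints] at hp
  exact tent_eq_zero (not_le.1 hp)

lemma tentDensity_eq_sum {x : E} {S : Finset D} (hS : nearPoints hD W x ⊆ S) :
    tentDensity D W x = ∑ p ∈ S, tent W (p : E) x :=
  tsum_eq_sum fun _ hp => tent_eq_zero_of_notMem hD fun h => hp (hS h)

lemma summable_tent (x : E) : Summable fun p : D => tent W (p : E) x :=
  summable_of_ne_finset_zero (s := nearPoints hD W x) fun _ hp => tent_eq_zero_of_notMem hD hp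

lemma ofReal_tentDensity (x : E) :
    ENNReal.ofReal (tentDensity D W x) = ∑' p : D, ENNReal.ofReal (tent W (p : E) x) :=
  ENNReal.ofReal_tsum_of_nonneg (fun _ => tent_nonneg _ _ _) (summable_tent hD x)

lemma tentDensity_le {N : ℕ} (hN : ∀ x, (nearPoints hD W x).card ≤ N) (hW : 0 ≤ W) (x : E) :
    tentDensity D W x ≤ N * W := by
  rw [tentDensity_eq_sum hD (Finset.Subset.refl _)]
  refine (Finset.sum_le_card_nsmul _ _ W fun p _ => tent_le hW _ _).trans ?_
  rw [nsmul_eq_mul]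
  gcongr
  exact hN x

lemma abs_tentDensity_sub_le {N : ℕ} (hN : ∀ x, (nearPoints hD W x).card ≤ N) (x y : E) :
    |tentDensity D W x - tentDensity D W y| ≤ (2 * N : ℝ) * ‖x - y‖ := by
  classical
  rw [tentDensity_eq_sum hD (Finset.subset_union_left (s₂ := nearPoints hD W y)),
    tentDensity_eq_sum hD (Finset.subset_union_right (s₁ := nearPoints hD W x)),
    ← Finset.sum_sub_distrib]
  refine (Finset.abs_sum_le_sum_abs _ _).trans ?_
  refine (Finset.sum_le_card_nsmul _ _ ‖x - y‖ fun p _ => abs_tent_sub_le _ _ _ _).trans ?_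
  rw [nsmul_eq_mul]
  gcongr
  have := (Finset.card_union_le (nearPoints hD W x) (nearPoints hD W y)).trans
    (add_le_add (hN x) (hN y))
  calc _ ≤ ((N + N : ℕ) : ℝ) := by exact_mod_cast this
    _ = _ := by push_cast; ring

lemma one_le_tentDensity {R : ℝ} (hR : ∀ x, ∃ p ∈ D, ‖x - p‖ ≤ R) (x : E) :
    1 ≤ tentDensity D (R + 1) x := by
  obtain ⟨p, hp, hpx⟩ := hR x
  have h1 := (summable_tent (W := R + 1) hD x).le_tsum ⟨p, hp⟩ fun _ _ => tent_nonneg _ _ _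
  refine le_trans ?_ h1
  exact le_max_of_le_right (by simp only; linarith)

omit hD in
lemma isLocalFunction_tentDensity : IsLocalFunction D W (tentDensity D W) := by
  intro x t hxt
  unfold tentDensity
  rw [tsum_subtype D (fun p => tent W p (x + t)), tsum_subtype D (fun p => tent W p x),
    ← (Equiv.addRight t).tsum_eq]
  refine tsum_congr fun p => ?_
  simp only [Equiv.coe_addRight]
  have h1 : tent W (p + t) (x + t) = tent W p x := by simp [tent]
  rcases le_or_gt ‖p - x‖ W with h | h
  · have := hxt p h
    by_cases hp : p ∈ D
    · rw [Set.indicator_of_mem hp, Set.indicator_of_mem (this.1 hp), h1]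
    · rw [Set.indicator_of_notMem hp, Set.indicator_of_notMem fun h => hp (this.2 h)]
  · rw [norm_sub_rev] at h
    have h2 := tent_eq_zero h
    rw [h2] at h1
    have i1 : D.indicator (fun p => tent W p (x + t)) (p + t) = 0 :=
      Set.indicator_apply_eq_zero.2 fun _ => h1
    have i2 : D.indicator (fun p => tent W p x) p = 0 := Set.indicator_apply_eq_zero.2 fun _ => h2
    rw [i1, i2]

lemma exists_card_nearPoints_le {C : ℝ} (hrep : PatchRepetitive D C) (hW : 1 ≤ W) :
    ∃ N : ℕ, ∀ x, (nearPoints hD W x).card ≤ N := by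
  classical
  refine ⟨(nearPoints hD (C * W + W) 0).card, fun x => ?_⟩
  obtain ⟨t, ht, hp⟩ := hrep W hW x 0
  refine Finset.card_le_card_of_injOn
    (fun p => if h : (p : E) + t ∈ D then ⟨p + t, h⟩ else p) (fun p hpm => ?_) ?_
  · have hpx := (mem_nearPoints hD).1 hpm
    have hm : (p : E) + t ∈ D := (hp p (by rwa [norm_sub_rev])).1 p.2
    simp only [hm, dite_true]
    refine (mem_nearPoints hD).2 ?_
    have h1 : (0 : E) - (p + t) = (x - p) - (x + t - 0) := by abel
    simp only
    rw [h1]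
    refine (norm_sub_le _ _).trans ?_
    linarith
  · intro p hpm q hqm hpq
    have hm : ∀ p ∈ nearPoints hD W x, (p : E) + t ∈ D := fun p hpm =>
      (hp p (by rw [norm_sub_rev]; exact (mem_nearPoints hD).1 hpm)).1 p.2
    simp only [hm p hpm, hm q hqm, dite_true, Subtype.mk.injEq, add_left_inj] at hpq
    exact Subtype.ext hpq

lemma countable_of_finite_inter_closedBall : D.Countable := by
  have : D = ⋃ n : ℕ, D ∩ Metric.closedBall 0 n := by
    rw [← Set.inter_iUnion, Metric.iUnion_closedBall_nat, Set.inter_univ]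
  rw [this]
  exact Set.countable_iUnion fun n => (hD 0 n).countable

end TentDensity

section Mass

variable {d : ℕ} {D : Set (Fin d → ℝ)} {W : ℝ}

/-- The total mass of a tent function. -/
noncomputable def tentMass (d : ℕ) (W : ℝ) : ENNReal :=
  ∫⁻ x : Fin d → ℝ, ENNReal.ofReal (tent W 0 x)

lemma lintegral_tent (p : Fin d → ℝ) :
    ∫⁻ x, ENNReal.ofReal (tent W p x) = tentMass d W := by
  have := lintegral_sub_right_eq_self (μ := volume)
    (fun x : Fin d → ℝ => ENNReal.ofReal (tent W 0 x)) p
  rw [tentMass, ← this]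
  simp [tent]

lemma tentMass_ne_top (hW : 0 ≤ W) : tentMass d W ≠ ⊤ := by
  have h : tentMass d W ≤ ∫⁻ x in Metric.closedBall (0 : Fin d → ℝ) W, ENNReal.ofReal W := by
    rw [tentMass, ← lintegral_indicator Metric.isClosed_closedBall.measurableSet]
    refine lintegral_mono fun x => ?_
    by_cases hx : x ∈ Metric.closedBall (0 : Fin d → ℝ) W
    · rw [Set.indicator_of_mem hx]
      exact ENNReal.ofReal_le_ofReal (tent_le hW _ _)
    · rw [Metric.mem_closedBall, dist_eq_norm, not_le] at hx
      simp [tent_eq_zero hx]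
  refine ne_top_of_le_ne_top ?_ h
  rw [setLIntegral_const]
  exact ENNReal.mul_ne_top ENNReal.ofReal_ne_top measure_closedBall_lt_top.ne

lemma tentMass_ne_zero (hW : 0 < W) : tentMass d W ≠ 0 := by
  intro h
  rw [tentMass, lintegral_eq_zero_iff (continuous_tent W _).measurable.ennreal_ofReal] at h
  have hc : Continuous fun x : Fin d → ℝ => ENNReal.ofReal (tent W 0 x) :=
    ENNReal.continuous_ofReal.comp (continuous_tent W 0)
  have := (hc.ae_eq_iff_eq volume continuous_zero).1 h
  have h0 := congrFun this 0
  simp only [tent, sub_zero, norm_zero, Pi.zero_apply, ENNReal.ofReal_eq_zero] at h0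
  exact absurd ((le_max_right _ _).trans h0) (not_le.2 hW)

variable (hD : ∀ x r, (D ∩ Metric.closedBall x r).Finite)
include hD

lemma card_mul_tentMass_le {A : Finset D} {φ : (Fin d → ℝ) → ENNReal}
    (hφ : ∀ p ∈ A, ∀ x, ‖x - (p : Fin d → ℝ)‖ ≤ W → 1 ≤ φ x) :
    A.card * tentMass d W ≤ ∫⁻ x, φ x * ENNReal.ofReal (tentDensity D W x) := by
  have h1 : A.card * tentMass d W = ∫⁻ x, ∑ p ∈ A, ENNReal.ofReal (tent W (p : Fin d → ℝ) x) := by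
    rw [lintegral_finsetSum _ fun p _ => (continuous_tent W _).measurable.ennreal_ofReal]
    simp [lintegral_tent]
  rw [h1]
  refine lintegral_mono fun x => ?_
  rw [ofReal_tentDensity hD, ← ENNReal.tsum_mul_left]
  refine le_trans (Finset.sum_le_sum fun p hp => ?_) (ENNReal.sum_le_tsum A)
  rcases le_or_gt ‖x - (p : Fin d → ℝ)‖ W with h | h
  · exact le_mul_of_one_le_left (zero_le) (hφ p hp x h)
  · simp [tent_eq_zero h]

lemma lintegral_tentDensity_le {A : Finset D} {φ : (Fin d → ℝ) → ENNReal} (hφm : Measurable φ)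
    (hφ1 : ∀ x, φ x ≤ 1) (hφ : ∀ p : D, ∀ x, ‖x - (p : Fin d → ℝ)‖ ≤ W → φ x ≠ 0 → p ∈ A) :
    ∫⁻ x, φ x * ENNReal.ofReal (tentDensity D W x) ≤ A.card * tentMass d W := by
  have : Countable D := (countable_of_finite_inter_closedBall hD).to_subtype
  simp only [ofReal_tentDensity hD, ← ENNReal.tsum_mul_left]
  rw [lintegral_tsum
    (f := fun (p : D) x => φ x * ENNReal.ofReal (tent W (p : Fin d → ℝ) x)) fun p =>
      (hφm.mul (continuous_tent W _).measurable.ennreal_ofReal).aemeasurable]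
  rw [tsum_eq_sum (s := A)]
  · refine (Finset.sum_le_card_nsmul _ _ (tentMass d W) fun p _ => ?_).trans (by simp)
    rw [← lintegral_tent (p : Fin d → ℝ)]
    exact lintegral_mono fun x => mul_le_of_le_one_left (zero_le) (hφ1 x)
  · intro p hp
    rw [← lintegral_zero (μ := volume) (α := Fin d → ℝ)]
    refine lintegral_congr fun x => ?_
    rcases le_or_gt ‖x - (p : Fin d → ℝ)‖ W with h | h
    · have : φ x = 0 := by
        by_contra h0
        exact hp (hφ p x h h0)
      simp [this]
    · simp [tent_eq_zero h]

end Mass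

section Comparison

variable {d : ℕ} [NeZero d] {D : Set (Fin d → ℝ)}

lemma lintegral_comp_iterComp {Λ : ℝ} {f : (Fin d → ℝ) → ℝ}
    {g : ℕ → (Fin d → ℝ) ≃ (Fin d → ℝ)} (hm : ∀ n, Measurable (g n))
    (hg : ∀ n, ∀ φ : (Fin d → ℝ) → ENNReal, Measurable φ →
      ∫⁻ x, φ (g n x) * ENNReal.ofReal (smoothing Λ f n x) =
        ∫⁻ x, φ x * ENNReal.ofReal (smoothing Λ f (n + 1) x)) (n : ℕ)
    {φ : (Fin d → ℝ) → ENNReal} (hφ : Measurable φ) :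
    ∫⁻ x, φ (iterComp g n x) * ENNReal.ofReal (f x) =
      ∫⁻ x, φ x * ENNReal.ofReal (smoothing Λ f n x) := by
  induction n generalizing φ with
  | zero => rfl
  | succ n ih =>
    rw [← hg n φ hφ]
    exact ih (hφ.comp (hm n))

omit [NeZero d] in
lemma lintegral_indicator_sub {S : Set (Fin d → ℝ)} (hS : MeasurableSet S) (h : Fin d → ℝ) :
    ∫⁻ z, S.indicator 1 (z - h) = volume S := by
  rw [lintegral_sub_right_eq_self (S.indicator (1 : (Fin d → ℝ) → ENNReal)) h,
    lintegral_indicator_one hS]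

theorem exists_volume_comparison (hD : ∀ x r, (D ∩ Metric.closedBall x r).Finite) {C R : ℝ}
    (hC : 1 ≤ C) (hrep : PatchRepetitive D C) (hR0 : 0 ≤ R) (hR : ∀ x, ∃ p ∈ D, ‖x - p‖ ≤ R) :
    ∃ (T : (Fin d → ℝ) → (Fin d → ℝ)) (K M a ρ : ℝ), 1 ≤ K ∧ 0 < a ∧ 0 < ρ ∧
      Function.Bijective T ∧
      (∀ x y, ‖T x - T y‖ ≤ K * ‖x - y‖ ∧ ‖x - y‖ ≤ K * ‖T x - T y‖) ∧
      (∀ (A : Finset D) (S : Set (Fin d → ℝ)), MeasurableSet S →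
        (∀ p ∈ A, Metric.closedBall (T p) M ⊆ S) →
        A.card * ENNReal.ofReal a ≤ ENNReal.ofReal ρ * volume S) ∧
      ∀ (A : Finset D) (S : Set (Fin d → ℝ)), MeasurableSet S → Bornology.IsBounded S →
        (∀ p : D, ∀ z ∈ S, ‖z - T p‖ ≤ M → p ∈ A) →
        ENNReal.ofReal ρ * volume S ≤ A.card * ENNReal.ofReal a := by
  set W := R + 1 with hWdef
  have hW : 1 ≤ W := by linarith
  have hW0 : 0 ≤ W := by linarith
  obtain ⟨N, hN⟩ := exists_card_nearPoints_le hD hrep hW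
  set f := tentDensity D W
  obtain ⟨Λ, ρ, δ, ω, hΛ, hρ, hδ, hlip, hsum, hω, hfρ, hf1⟩ := exists_smoothing_limit hC hW hrep
    isLocalFunction_tentDensity (abs_tentDensity_sub_le hD hN) (one_le_tentDensity hD hR)
    (tentDensity_le hD hN hW0)
  choose g hg hg' hgφ using fun n => exists_transport_lineAverage (L := Λ ^ (n / d))
    (pow_pos hΛ _) (hlip n) (hf1 n) (Fin.ofNat d n)
  obtain ⟨T, K, τ, hK, hT, hTK, hHK, hτ, hHT⟩ := exists_limit_iterComp
    (κ := fun n => 2 * Λ ^ (n / d) * δ n) (fun n => by have := hδ n; positivity)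
    (by simpa only [mul_assoc] using hsum.mul_left 2) hg hg'
  have hgm : ∀ n, Measurable (g n) := fun n => by
    have h1 : Continuous fun x => g n x - x := by
      refine (LipschitzWith.of_dist_le_mul (K := (2 * Λ ^ (n / d) * δ n).toNNReal)
        fun x y => ?_).continuous
      have := hδ n
      rw [Real.coe_toNNReal _ (by positivity), dist_eq_norm, dist_eq_norm]
      exact hg n x y
    have h2 : ⇑(g n) = fun x => (g n x - x) + x := by simp
    rw [h2]
    exact (h1.add continuous_id).measurable
  have key : ∀ n, ∀ φ : (Fin d → ℝ) → ENNReal, Measurable φ →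
      ∫⁻ x, φ (iterComp g n x) * ENNReal.ofReal (f x) =
        ∫⁻ x, φ x * ENNReal.ofReal (smoothing Λ f n x) := fun n φ hφ =>
    lintegral_comp_iterComp hgm hgφ n hφ
  have hHm : ∀ n, Measurable (iterComp g n) := fun n => by
    refine (LipschitzWith.of_dist_le_mul (K := K.toNNReal) fun x y => ?_).continuous.measurable
    rw [Real.coe_toNNReal _ (by linarith), dist_eq_norm, dist_eq_norm]
    exact (hHK n x y).1
  have hm0 : ENNReal.ofReal (tentMass d W).toReal = tentMass d W :=
    ENNReal.ofReal_toReal (tentMass_ne_top hW0)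
  have hnear : ∀ n x p, ‖x - p‖ ≤ W →
      ‖iterComp g n x - iterComp g n 0 - T p‖ ≤ K * W + |τ n| * ‖p‖ := fun n x p hx => by
    have h1 : iterComp g n x - iterComp g n 0 - T p = (iterComp g n x - iterComp g n p) +
      (iterComp g n p - iterComp g n 0 - T p) := by abel
    rw [h1]
    refine (norm_add_le _ _).trans (add_le_add ((hHK n x p).1.trans (by gcongr))
      ((hHT n p).trans ?_))
    gcongr
    exact le_abs_self _
  have hτ' : ∀ B : ℝ, ∀ᶠ n in atTop, |τ n| * B ≤ 1 := fun B => by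
    have h1 : Tendsto (fun n => |τ n| * B) atTop (𝓝 0) := by
      simpa using hτ.abs.mul_const B
    exact h1.eventually_le_const one_pos
  have hρ0 : 0 < ρ := by linarith
  have hlim : ∀ (c : ℝ) (S : Set (Fin d → ℝ)),
      Tendsto (fun n => ENNReal.ofReal (ρ + c * ω n) * volume S) atTop
        (𝓝 (ENNReal.ofReal ρ * volume S)) := fun c S => by
    have h1 : Tendsto (fun n => ρ + c * ω n) atTop (𝓝 ρ) := by
      simpa using (hω.const_mul c).const_add ρ
    exact ENNReal.Tendsto.mul_const (ENNReal.tendsto_ofReal h1) (Or.inl (by simpa using hρ0))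
  refine ⟨T, K, K * W + 1, (tentMass d W).toReal, ρ, hK,
    ENNReal.toReal_pos (tentMass_ne_zero (by linarith)) (tentMass_ne_top hW0), hρ0, hT, hTK,
    fun A S hS hA => ?_, fun A S hS hSb hA => ?_⟩
  · rw [hm0]
    refine ge_of_tendsto (hlim 1 S) ?_
    have h1 : ∀ᶠ n in atTop, ∀ p ∈ A, |τ n| * ‖(p : Fin d → ℝ)‖ ≤ 1 :=
      (Finset.eventually_all A).2 fun p _ => hτ' _
    filter_upwards [h1] with n hn
    have hφ : Measurable fun z => S.indicator (1 : (Fin d → ℝ) → ENNReal) (z - iterComp g n 0) :=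
      (measurable_one.indicator hS).comp (measurable_id.sub_const _)
    refine (card_mul_tentMass_le hD (W := W) (φ := fun x => S.indicator (1 : (Fin d → ℝ) → ENNReal)
      (iterComp g n x - iterComp g n 0)) fun p hp x hx => ?_).trans ?_
    · rw [Set.indicator_of_mem]
      · rfl
      · refine hA p hp ?_
        rw [Metric.mem_closedBall, dist_eq_norm]
        exact (hnear n x p hx).trans (by linarith [hn p hp])
    · rw [key n _ hφ, ← lintegral_indicator_sub hS (iterComp g n 0), mul_comm,
        ← lintegral_mul_const _ hφ]
      refine lintegral_mono fun z => ?_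
      gcongr
      linarith [abs_le.1 (hfρ n z)]
  · rw [hm0]
    obtain ⟨B, hB⟩ := hSb.exists_norm_le
    refine le_of_tendsto (hlim (-1) S) ?_
    filter_upwards [hτ' (K * B + W)] with n hn
    have hφ : Measurable fun z => S.indicator (1 : (Fin d → ℝ) → ENNReal) (z - iterComp g n 0) :=
      (measurable_one.indicator hS).comp (measurable_id.sub_const _)
    refine le_trans ?_ (lintegral_tentDensity_le hD (W := W) (A := A)
      (φ := fun x => S.indicator (1 : (Fin d → ℝ) → ENNReal)
      (iterComp g n x - iterComp g n 0)) (hφ.comp (hHm n))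
      (fun x => Set.indicator_le_self' (fun _ _ => zero_le) _) fun p x hx h0 => ?_)
    · rw [key n _ hφ, ← lintegral_indicator_sub hS (iterComp g n 0), mul_comm,
        ← lintegral_mul_const _ hφ]
      refine lintegral_mono fun z => ?_
      gcongr
      linarith [abs_le.1 (hfρ n z)]
    · have hz := Set.mem_of_indicator_ne_zero h0
      refine hA p _ hz ((hnear n x p hx).trans ?_)
      have h1 : ‖x‖ ≤ K * B := by
        have := (hHK n x 0).2
        rw [sub_zero] at this
        exact this.trans (by gcongr; exact hB _ hz)
      have h2 : ‖(p : Fin d → ℝ)‖ ≤ K * B + W := by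
        have := norm_sub_norm_le (p : Fin d → ℝ) x
        rw [norm_sub_rev] at this
        linarith
      have h3 : |τ n| * ‖(p : Fin d → ℝ)‖ ≤ |τ n| * (K * B + W) := by gcongr
      linarith

end Comparison

section Matching

lemma exists_injective_of_card_le {α β : Type*} {r : α → β → Prop}
    (hfin : ∀ a, {b | r a b}.Finite)
    (hcard : ∀ (A : Finset α) (B : Finset β), (∀ a ∈ A, ∀ b, r a b → b ∈ B) → A.card ≤ B.card) :
    ∃ f : α → β, Function.Injective f ∧ ∀ a, r a (f a) := by
  classical
  obtain ⟨f, hf, hr⟩ := (Finset.all_card_le_biUnion_card_iff_exists_injective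
    fun a => (hfin a).toFinset).1 fun A => hcard A _ fun a ha b hab =>
      Finset.mem_biUnion.2 ⟨a, ha, by simpa using hab⟩
  exact ⟨f, hf, fun a => by simpa using hr a⟩

variable {d : ℕ}

/-- The half-open cube of side `1 / s` with lower corner `q / s`. -/
def latticeCube (s : ℝ) (q : Fin d → ℤ) : Set (Fin d → ℝ) :=
  Set.univ.pi fun i => Set.Ico ((q i : ℝ) / s) ((q i + 1) / s)

lemma mem_latticeCube {s : ℝ} (hs : 0 < s) {q : Fin d → ℤ} {z : Fin d → ℝ} :
    z ∈ latticeCube s q ↔ ∀ i, ⌊s * z i⌋ = q i := by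
  simp only [latticeCube, Set.mem_univ_pi, Set.mem_Ico, Int.floor_eq_iff, div_le_iff₀' hs,
    lt_div_iff₀' hs]

lemma measurableSet_latticeCube (s : ℝ) (q : Fin d → ℤ) : MeasurableSet (latticeCube s q) :=
  MeasurableSet.univ_pi fun _ => measurableSet_Ico

lemma volume_latticeCube {s : ℝ} (hs : 0 < s) (q : Fin d → ℤ) :
    volume (latticeCube s q) = ENNReal.ofReal ((s ^ d)⁻¹) := by
  have h : ∀ i, ((q i : ℝ) + 1) / s - q i / s = s⁻¹ := fun i => by field_simp; ring
  simp only [latticeCube, Real.volume_pi_Ico, h, Finset.prod_const, Finset.card_univ,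
    Fintype.card_fin]
  rw [← ENNReal.ofReal_pow (by positivity), inv_pow]

lemma isBounded_latticeCube (s : ℝ) (q : Fin d → ℤ) : Bornology.IsBounded (latticeCube s q) :=
  Bornology.IsBounded.pi fun _ => Metric.isBounded_Ico _ _

lemma disjoint_latticeCube {s : ℝ} (hs : 0 < s) {q q' : Fin d → ℤ} (h : q ≠ q') :
    Disjoint (latticeCube s q) (latticeCube s q') := by
  refine Set.disjoint_left.2 fun z hz hz' => h (funext fun i => ?_)
  rw [← (mem_latticeCube hs).1 hz i, (mem_latticeCube hs).1 hz' i]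

lemma norm_smul_sub_le_of_mem_latticeCube {s : ℝ} (hs : 0 < s) {q : Fin d → ℤ} {z : Fin d → ℝ}
    (hz : z ∈ latticeCube s q) : ‖s • z - fun i => (q i : ℝ)‖ ≤ 1 := by
  refine (pi_norm_le_iff_of_nonneg zero_le_one).2 fun i => ?_
  have h := (mem_latticeCube hs).1 hz i
  rw [Pi.sub_apply, Pi.smul_apply, smul_eq_mul, ← h, Real.norm_eq_abs, abs_le]
  constructor <;> linarith [Int.floor_le (s * z i), Int.lt_floor_add_one (s * z i)]

lemma finite_norm_sub_intCast_le (v : Fin d → ℝ) (M : ℝ) :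
    {q : Fin d → ℤ | ‖v - fun i => (q i : ℝ)‖ ≤ M}.Finite := by
  refine (Set.finite_Icc (fun i => ⌈v i - M⌉) (fun i => ⌊v i + M⌋)).subset fun q hq => ?_
  have h : ∀ i, |v i - q i| ≤ M := fun i =>
    (norm_le_pi_norm (v - fun i => (q i : ℝ)) i).trans hq
  refine ⟨fun i => Int.ceil_le.2 ?_, fun i => Int.le_floor.2 ?_⟩ <;>
    linarith [abs_le.1 (h i)]

theorem exists_biLipschitz_near_lattice [NeZero d] {D : Set (Fin d → ℝ)}
    (hD : ∀ x r, (D ∩ Metric.closedBall x r).Finite) {C R : ℝ}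
    (hC : 1 ≤ C) (hrep : PatchRepetitive D C) (hR0 : 0 ≤ R) (hR : ∀ x, ∃ p ∈ D, ‖x - p‖ ≤ R) :
    ∃ (T : (Fin d → ℝ) → (Fin d → ℝ)) (K M : ℝ), 1 ≤ K ∧ Function.Bijective T ∧
      (∀ x y, ‖T x - T y‖ ≤ K * ‖x - y‖ ∧ ‖x - y‖ ≤ K * ‖T x - T y‖) ∧
      ∃ Φ : D → (Fin d → ℤ), Function.Bijective Φ ∧
        ∀ p : D, ‖T p - fun i => (Φ p i : ℝ)‖ ≤ M := by
  obtain ⟨T, K, M, a, ρ, hK, ha, hρ, hT, hTK, hI, hII⟩ :=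
    exists_volume_comparison hD hC hrep hR0 hR
  obtain ⟨s, hs, hsd⟩ : ∃ s : ℝ, 0 < s ∧ s ^ d = ρ / a :=
    ⟨(ρ / a) ^ (d : ℝ)⁻¹, by positivity, Real.rpow_inv_natCast_pow (by positivity) (NeZero.ne d)⟩
  have hvol : ∀ n : ℕ, ENNReal.ofReal ρ * (n * ENNReal.ofReal ((s ^ d)⁻¹)) =
      n * ENNReal.ofReal a := fun n => by
    rw [mul_left_comm, ← ENNReal.ofReal_mul hρ.le, hsd]
    congr 2
    field_simp
  have hcancel : ∀ m n : ℕ, m * ENNReal.ofReal a ≤ n * ENNReal.ofReal a → m ≤ n := fun m n h => by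
    have := (ENNReal.mul_le_mul_iff_left (by simpa using ha) ENNReal.ofReal_ne_top).1 h
    exact_mod_cast this
  have hnear : ∀ (p : D) (z : Fin d → ℝ) (q : Fin d → ℤ), z ∈ latticeCube s q → ‖z - T p‖ ≤ M →
      ‖s • T p - fun i => (q i : ℝ)‖ ≤ s * M + 1 := fun p z q hz hp => by
    have h1 : (s • T p - fun i => (q i : ℝ)) = s • (T p - z) + (s • z - fun i => (q i : ℝ)) := by
      rw [smul_sub]; abel
    rw [h1]
    refine (norm_add_le _ _).trans (add_le_add ?_ (norm_smul_sub_le_of_mem_latticeCube hs hz))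
    rw [norm_smul, Real.norm_eq_abs, abs_of_pos hs, norm_sub_rev]
    gcongr
  obtain ⟨f, hf, hfr⟩ := exists_injective_of_card_le
    (r := fun (p : D) (q : Fin d → ℤ) => ‖s • T p - fun i => (q i : ℝ)‖ ≤ s * M + 1)
    (fun p => finite_norm_sub_intCast_le _ _) fun A B hAB => by
      refine hcancel _ _ ((hI A (⋃ q ∈ B, latticeCube s q)
        (B.measurableSet_biUnion fun q _ => measurableSet_latticeCube s q)
        fun p hp z hz => ?_).trans ?_)
      · rw [Metric.mem_closedBall, dist_eq_norm] at hz
        have hz' : z ∈ latticeCube s fun i => ⌊s * z i⌋ := (mem_latticeCube hs).2 fun i => rfl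
        exact Set.mem_biUnion (hAB p hp _ (hnear p z _ hz' hz)) hz'
      · rw [← hvol]
        gcongr
        refine (measure_biUnion_finset_le _ _).trans ?_
        simp [volume_latticeCube hs]
  obtain ⟨g, hg, hgr⟩ := exists_injective_of_card_le
    (r := fun (q : Fin d → ℤ) (p : D) => ‖s • T p - fun i => (q i : ℝ)‖ ≤ s * M + 1)
    (fun q => by
      obtain ⟨x, hx⟩ := hT.2 (s⁻¹ • fun i => (q i : ℝ))
      refine (((hD x (K * (s⁻¹ * (s * M + 1)))).preimage Subtype.val_injective.injOn)).subset
        fun p hp => ⟨p.2, ?_⟩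
      rw [Metric.mem_closedBall, dist_eq_norm]
      refine (hTK p x).2.trans ?_
      have h1 : T p - T x = s⁻¹ • (s • T p - fun i => (q i : ℝ)) := by
        rw [hx, smul_sub, inv_smul_smul₀ hs.ne']
      rw [h1, norm_smul, Real.norm_eq_abs, abs_of_pos (inv_pos.2 hs)]
      gcongr
      exact hp) fun A B hAB => by
      have h1 := hII B (⋃ q ∈ A, latticeCube s q)
        (A.measurableSet_biUnion fun q _ => measurableSet_latticeCube s q)
        ((Bornology.isBounded_biUnion_finset A).2 fun q _ => isBounded_latticeCube s q)
        fun p z hz hp => by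
          obtain ⟨q, hq, hzq⟩ := Set.mem_iUnion₂.1 hz
          exact hAB q hq p (hnear p z q hzq hp)
      rw [measure_biUnion_finset (fun q _ q' _ h => disjoint_latticeCube hs h)
        fun q _ => measurableSet_latticeCube s q] at h1
      simp only [volume_latticeCube hs, Finset.sum_const, nsmul_eq_mul, hvol] at h1
      exact hcancel _ _ h1
  obtain ⟨Φ, hΦ, hΦr⟩ := Function.Embedding.schroeder_bernstein_of_rel hf hg
    (fun (p : D) (q : Fin d → ℤ) => ‖s • T p - fun i => (q i : ℝ)‖ ≤ s * M + 1) hfr hgr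
  have hsT : ∀ x y, ‖s • T x - s • T y‖ = s * ‖T x - T y‖ := fun x y => by
    rw [← smul_sub, norm_smul, Real.norm_eq_abs, abs_of_pos hs]
  refine ⟨fun x => s • T x, max s s⁻¹ * K, s * M + 1, ?_, ?_, fun x y => ⟨?_, ?_⟩, Φ, hΦ, hΦr⟩
  · refine one_le_mul_of_one_le_of_one_le ?_ hK
    rcases le_total 1 s with h | h
    · exact le_max_of_le_left h
    · exact le_max_of_le_right ((one_le_inv₀ hs).2 h)
  · exact (MulAction.bijective (Units.mk0 s hs.ne')).comp hT
  · rw [hsT, mul_assoc]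
    gcongr
    · exact le_max_left _ _
    · exact (hTK x y).1
  · rw [hsT]
    calc ‖x - y‖ ≤ K * ‖T x - T y‖ := (hTK x y).2
      _ = s⁻¹ * K * (s * ‖T x - T y‖) := by field_simp
      _ ≤ max s s⁻¹ * K * (s * ‖T x - T y‖) := by
        gcongr
        exact le_max_right _ _

end Matching

section Euclidean

lemma finite_inter_closedBall_of_le_dist {E : Type*} [MetricSpace E] [ProperSpace E] {D : Set E}
    {r : ℝ} (hr : 0 < r) (hD : ∀ x ∈ D, ∀ y ∈ D, x ≠ y → r ≤ dist x y) (x : E) (ρ : ℝ) :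
    (D ∩ Metric.closedBall x ρ).Finite := by
  have hp : D.Pairwise fun x y => r ≤ dist x y := fun x hx y hy h => hD x hx y hy h
  have hdisc : DiscreteTopology D := DiscreteTopology.of_forall_le_dist hr fun a b h =>
    hD a a.2 b b.2 fun h' => h (Subtype.ext h')
  rw [Set.inter_comm]
  exact Metric.finite_isBounded_inter_isClosed ⟨hdisc⟩ Metric.isBounded_closedBall
    (Metric.isClosed_of_pairwise_le_dist hr hp)

variable {E F : Type*} [NormedAddCommGroup E] [NormedAddCommGroup F] [NormedSpace ℝ E]
  [NormedSpace ℝ F]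

lemma exists_norm_le_mul_norm_equiv (e : E ≃L[ℝ] F) :
    ∃ c : ℝ, 1 ≤ c ∧ (∀ x, ‖e x‖ ≤ c * ‖x‖) ∧ ∀ y, ‖e.symm y‖ ≤ c * ‖y‖ := by
  refine ⟨max 1 (max ‖(e : E →L[ℝ] F)‖ ‖(e.symm : F →L[ℝ] E)‖), le_max_left _ _, fun x => ?_,
    fun y => ?_⟩
  · refine ((e : E →L[ℝ] F).le_opNorm x).trans ?_
    gcongr
    exact (le_max_left _ _).trans (le_max_right _ _)
  · refine ((e.symm : F →L[ℝ] E).le_opNorm y).trans ?_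
    gcongr
    exact (le_max_right _ _).trans (le_max_right _ _)

omit [NormedSpace ℝ E] in
lemma samePatch_of_image_eq {D : Set E} {ρ : ℝ} {x t : E}
    (h : (fun p => t + p) '' (D ∩ Metric.closedBall x ρ) = D ∩ Metric.closedBall (x + t) ρ) :
    SamePatch D ρ x t := by
  intro p hp
  have hm : p ∈ Metric.closedBall x ρ := by rwa [Metric.mem_closedBall, dist_eq_norm]
  constructor
  · intro hpD
    have h1 : t + p ∈ D ∩ Metric.closedBall (x + t) ρ := h ▸ Set.mem_image_of_mem _ ⟨hpD, hm⟩
    rw [add_comm]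
    exact h1.1
  · intro hpD
    have h1 : p + t ∈ D ∩ Metric.closedBall (x + t) ρ :=
      ⟨hpD, by rwa [Metric.mem_closedBall, dist_eq_norm, add_sub_add_right_eq_sub]⟩
    rw [← h] at h1
    obtain ⟨p', hp', heq⟩ := h1
    have h2 : p' = p := by
      simp only at heq
      rwa [add_comm, add_left_inj] at heq
    exact h2 ▸ hp'.1

lemma PatchRepetitive.preimage_symm (e : E ≃L[ℝ] F) {c : ℝ} (hc : 1 ≤ c)
    (h1 : ∀ x, ‖e x‖ ≤ c * ‖x‖) (h2 : ∀ y, ‖e.symm y‖ ≤ c * ‖y‖) {D : Set E} {C : ℝ}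
    (hD : PatchRepetitive D C) : PatchRepetitive (e.symm ⁻¹' D) (c * C * c) := by
  intro r hr x y
  have hcr : 1 ≤ c * r := one_le_mul_of_one_le_of_one_le hc hr
  obtain ⟨t, ht, hp⟩ := hD (c * r) hcr (e.symm x) (e.symm y)
  refine ⟨e t, ?_, fun p hpx => ?_⟩
  · have h3 : x + e t - y = e (e.symm x + t - e.symm y) := by simp
    rw [h3]
    calc _ ≤ c * ‖e.symm x + t - e.symm y‖ := h1 _
      _ ≤ c * (C * (c * r)) := by gcongr
      _ = _ := by ring
  · have h3 := hp (e.symm p) (by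
      rw [← map_sub]
      exact (h2 _).trans (by gcongr))
    simpa using h3

lemma bijective_intCast_intLattice (d : ℕ) : Function.Bijective
    (fun q : Fin d → ℤ => (⟨(EuclideanSpace.equiv (Fin d) ℝ).symm fun i => (q i : ℝ),
      fun i => ⟨q i, rfl⟩⟩ : intLattice d)) := by
  constructor
  · intro q q' h
    have h1 : (fun i => (q i : ℝ)) = fun i => (q' i : ℝ) :=
      (EuclideanSpace.equiv (Fin d) ℝ).symm.injective (congrArg Subtype.val h)
    exact funext fun i => Int.cast_injective (congrFun h1 i)
  · rintro ⟨x, hx⟩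
    choose q hq using id hx
    refine ⟨q, Subtype.ext ?_⟩
    ext i
    exact (hq i).symm

end Euclidean

/-- For a linearly repetitive Delone set D in ℝ^d there is a bi-Lipschitz homeomorphism H
of ℝ^d such that H(D) is a boundedly displaced image of ℤ^d. -/
theorem linearly_repetitive_delone_biLipschitz_to_boundedly_displaced
    (d : ℕ) (hd : 1 ≤ d) (D : Set (EuclideanSpace ℝ (Fin d)))
    -- D is a Delone set:
    (r R : ℝ) (hr : 0 < r) (hR : 0 < R)
    (hUnifDisc : ∀ x ∈ D, ∀ y ∈ D, x ≠ y → r ≤ dist x y)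
    (hRelDense : ∀ x : EuclideanSpace ℝ (Fin d), ∃ y ∈ D, dist x y ≤ R)
    -- D is linearly repetitive:
    (C : ℝ) (hC : 1 ≤ C)
    (hLinRep : ∀ ρ : ℝ, 1 ≤ ρ → ∀ x y : EuclideanSpace ℝ (Fin d),
      ∃ t : EuclideanSpace ℝ (Fin d),
        (fun p => t + p) '' (D ∩ Metric.closedBall x ρ) = D ∩ Metric.closedBall (x + t) ρ ∧
        Metric.closedBall (x + t) ρ ⊆ Metric.closedBall y (C * ρ)) :
    -- conclusion: a bi-Lipschitz homeomorphism H of ℝ^d such that H(D) is a boundedly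
    -- displaced image of ℤ^d
    ∃ H : EuclideanSpace ℝ (Fin d) → EuclideanSpace ℝ (Fin d),
      Function.Bijective H ∧
      (∃ K : ℝ, 1 ≤ K ∧ ∀ u v : EuclideanSpace ℝ (Fin d),
        (1 / K) * ‖u - v‖ ≤ ‖H u - H v‖ ∧ ‖H u - H v‖ ≤ K * ‖u - v‖) ∧
      ∃ Φ : (H '' D) → intLattice d, Function.Bijective Φ ∧
        ∃ M : ℝ, ∀ s : (H '' D),
          ‖(Φ s : EuclideanSpace ℝ (Fin d)) - (s : EuclideanSpace ℝ (Fin d))‖ ≤ M := by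
  have : NeZero d := ⟨by omega⟩
  set e := EuclideanSpace.equiv (Fin d) ℝ
  obtain ⟨c, hc, hc1, hc2⟩ := exists_norm_le_mul_norm_equiv e
  have hc0 : 0 ≤ c := zero_le_one.trans hc
  have hrep : PatchRepetitive D C := fun ρ hρ x y => by
    obtain ⟨t, ht, hsub⟩ := hLinRep ρ hρ x y
    have h1 := hsub (Metric.mem_closedBall_self (by linarith))
    rw [Metric.mem_closedBall, dist_eq_norm] at h1
    exact ⟨t, h1, samePatch_of_image_eq ht⟩
  have hfin : ∀ x ρ, ((e.symm ⁻¹' D) ∩ Metric.closedBall x ρ).Finite := fun x ρ => by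
    refine ((finite_inter_closedBall_of_le_dist hr hUnifDisc (e.symm x) (c * ρ)).preimage
      e.symm.injective.injOn).subset fun p hp => ⟨hp.1, ?_⟩
    have h1 := hp.2
    rw [Metric.mem_closedBall, dist_eq_norm] at h1 ⊢
    rw [← map_sub]
    exact (hc2 _).trans (by gcongr)
  have hdense : ∀ x, ∃ p ∈ e.symm ⁻¹' D, ‖x - p‖ ≤ c * R := fun x => by
    obtain ⟨y, hy, hxy⟩ := hRelDense (e.symm x)
    refine ⟨e y, by simpa using hy, ?_⟩
    have h1 : x - e y = e (e.symm x - y) := by simp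
    rw [h1]
    rw [dist_eq_norm] at hxy
    exact (hc1 _).trans (by gcongr)
  obtain ⟨T, K, M, hK, hT, hTK, Φ, hΦ, hΦM⟩ := exists_biLipschitz_near_lattice hfin
    (one_le_mul_of_one_le_of_one_le (one_le_mul_of_one_le_of_one_le hc hC) hc)
    (hrep.preimage_symm e hc hc1 hc2) (by positivity) hdense
  have hK0 : 0 < K := by linarith
  have hH : Function.Bijective fun x => e.symm (T (e x)) :=
    e.symm.bijective.comp (hT.comp e.bijective)
  refine ⟨fun x => e.symm (T (e x)), hH, ⟨c * K * c,
    one_le_mul_of_one_le_of_one_le (one_le_mul_of_one_le_of_one_le hc hK) hc,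
    fun u v => ⟨?_, ?_⟩⟩, ?_⟩
  · rw [one_div, inv_mul_le_iff₀ (by positivity)]
    have h1 : u - v = e.symm (e u - e v) := by simp
    have h2 : T (e u) - T (e v) = e (e.symm (T (e u)) - e.symm (T (e v))) := by simp
    calc ‖u - v‖ ≤ c * ‖e u - e v‖ := by rw [h1]; simpa using hc2 (e u - e v)
      _ ≤ c * (K * ‖T (e u) - T (e v)‖) := by gcongr; exact (hTK _ _).2
      _ ≤ c * (K * (c * ‖e.symm (T (e u)) - e.symm (T (e v))‖)) := by
        rw [h2]
        gcongr
        exact hc1 _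
      _ = _ := by ring
  · rw [← map_sub]
    calc _ ≤ c * ‖T (e u) - T (e v)‖ := hc2 _
      _ ≤ c * (K * ‖e u - e v‖) := by gcongr; exact (hTK _ _).1
      _ ≤ c * (K * (c * ‖u - v‖)) := by
        rw [← map_sub]
        gcongr
        exact hc1 _
      _ = _ := by ring
  · let imageEquiv := Equiv.Set.image _ D hH.injective
    let preimageEquiv : D ≃ e.symm ⁻¹' D := e.toEquiv.subtypeEquiv fun a => by simp
    let latticeEquiv := Equiv.ofBijective _ (bijective_intCast_intLattice d)
    refine ⟨imageEquiv.symm.trans (preimageEquiv.trans ((Equiv.ofBijective Φ hΦ).trans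
      latticeEquiv)), Equiv.bijective _, c * M, fun s => ?_⟩
    obtain ⟨v, rfl⟩ := imageEquiv.surjective s
    rw [Equiv.trans_apply, Equiv.symm_apply_apply]
    change ‖e.symm (fun i => (Φ (preimageEquiv v) i : ℝ)) - e.symm (T (preimageEquiv v))‖ ≤ c * M
    rw [← map_sub]
    refine (hc2 _).trans ?_
    rw [norm_sub_rev]
    gcongr
    exact hΦM _
end

section
/- Let d ≥ 2, let v, w be points of ℝ^d, and let ε > 0. Then there exists a bi-Lipschitz homeomorphism G : ℝ^d → ℝ^d such that G(v) = w, G(u) = u for every u outside the open ε/2-neighborhood of the segment [v, w], and the bi-Lipschitz constant of G is bounded above by a constant depending only on d, ε and ‖v − w‖ (in particular, it can be taken uniformly bounded over all pairs (v, w) with ‖v − w‖ bounded by a fixed constant). -/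
open scoped NNReal in
theorem bijective_add_of_lipschitz_half {E : Type*} [NormedAddCommGroup E] [CompleteSpace E]
    {φ : E → E} (hφ : ∀ u u', ‖φ u - φ u'‖ ≤ 1 / 2 * ‖u - u'‖) :
    Function.Bijective (fun u => u + φ u) ∧
      ∀ u u', (1 / 2) * ‖u - u'‖ ≤ ‖(u + φ u) - (u' + φ u')‖ ∧
        ‖(u + φ u) - (u' + φ u')‖ ≤ 2 * ‖u - u'‖ := by
  have bounds : ∀ u u', (1 / 2) * ‖u - u'‖ ≤ ‖(u + φ u) - (u' + φ u')‖ ∧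
      ‖(u + φ u) - (u' + φ u')‖ ≤ 2 * ‖u - u'‖ := by
    intro u u'
    have h := hφ u u'
    have hn := norm_nonneg (u - u')
    rw [add_sub_add_comm]
    have upper := norm_add_le (u - u') (φ u - φ u')
    have lower := norm_sub_le_norm_add (u - u') (φ u - φ u')
    constructor <;> linarith
  refine ⟨⟨fun u u' h => ?_, fun y => ?_⟩, bounds⟩
  · have h' := (bounds u u').1
    simp only at h
    rw [h, sub_self, norm_zero] at h'
    have : ‖u - u'‖ = 0 := le_antisymm (by linarith) (norm_nonneg _)
    exact sub_eq_zero.mp (norm_eq_zero.mp this)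
  · have contracting : ContractingWith (1 / 2 : ℝ≥0) (fun u => y - φ u) := by
      refine ⟨by rw [← NNReal.coe_lt_coe]; norm_num, LipschitzWith.of_dist_le_mul fun u u' => ?_⟩
      rw [dist_sub_left, dist_eq_norm, dist_eq_norm]
      simpa using hφ u u'
    refine ⟨contracting.fixedPoint, ?_⟩
    have h : y - φ contracting.fixedPoint = contracting.fixedPoint :=
      contracting.fixedPoint_isFixedPt
    exact (sub_eq_iff_eq_add.mp h).symm

theorem exists_biLipschitz_push {E : Type*} [NormedAddCommGroup E] [NormedSpace ℝ E]
    [CompleteSpace E] {r : ℝ} (hr : 0 < r) {v w : E} (hvw : ‖v - w‖ ≤ r / 2) :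
    ∃ G : E → E, Function.Bijective G ∧ G v = w ∧ (∀ u, r ≤ dist u v → G u = u) ∧
      ∀ u u', (1 / 2) * ‖u - u'‖ ≤ ‖G u - G u'‖ ∧ ‖G u - G u'‖ ≤ 2 * ‖u - u'‖ := by
  obtain ⟨bij, bounds⟩ := bijective_add_of_lipschitz_half
    (φ := fun u => max 0 (1 - dist u v / r) • (w - v)) fun u u' => by
      rw [← sub_smul, norm_smul, Real.norm_eq_abs, norm_sub_rev w v]
      have h : |max 0 (1 - dist u v / r) - max 0 (1 - dist u' v / r)| ≤ ‖u - u'‖ / r := by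
        calc _ ≤ |(1 - dist u v / r) - (1 - dist u' v / r)| := by
              simpa only [max_comm (0 : ℝ)] using abs_max_sub_max_le_abs _ _ (0 : ℝ)
          _ = |dist u' v - dist u v| / r := by
              rw [sub_sub_sub_cancel_left, ← sub_div, abs_div, abs_of_pos hr]
          _ ≤ ‖u - u'‖ / r := by
              rw [← dist_eq_norm, dist_comm u u']
              gcongr
              exact abs_dist_sub_le _ _ _
      calc _ ≤ ‖u - u'‖ / r * (r / 2) := by gcongr
        _ = 1 / 2 * ‖u - u'‖ := by field_simp
  refine ⟨_, bij, by simp, fun u hu => ?_, bounds⟩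
  have : 1 - dist u v / r ≤ 0 := sub_nonpos.mpr ((one_le_div hr).mpr hu)
  simp [max_eq_left this]

theorem exists_biLipschitz_chain {E : Type*} [NormedAddCommGroup E] [NormedSpace ℝ E]
    [CompleteSpace E] {r : ℝ} (hr : 0 < r) (n : ℕ) (v w : E) (hvw : ‖v - w‖ ≤ n * (r / 2)) :
    ∃ G : E → E, Function.Bijective G ∧ G v = w ∧
      (∀ u, (∀ x ∈ segment ℝ v w, r ≤ dist u x) → G u = u) ∧
      ∀ u u', (1 / 2 ^ n) * ‖u - u'‖ ≤ ‖G u - G u'‖ ∧ ‖G u - G u'‖ ≤ 2 ^ n * ‖u - u'‖ := by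
  induction n generalizing v with
  | zero =>
    have : v = w := sub_eq_zero.mp (norm_le_zero_iff.mp (by simpa using hvw))
    exact ⟨id, Function.bijective_id, this, fun _ _ => rfl, by simp⟩
  | succ n ih =>
    push_cast at hvw
    have hn : (0 : ℝ) < n + 1 := by positivity
    set p : E := AffineMap.lineMap v w (1 / (n + 1) : ℝ) with hp
    have hp_mem : p ∈ segment ℝ v w := by
      rw [segment_eq_image_lineMap]
      exact ⟨_, ⟨by positivity, by rw [div_le_one hn]; linarith [n.cast_nonneg (α := ℝ)]⟩, rfl⟩
    have hvp : ‖v - p‖ ≤ r / 2 := by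
      rw [← dist_eq_norm, hp, dist_left_lineMap, Real.norm_eq_abs, abs_of_pos (by positivity),
        dist_eq_norm, one_div_mul_eq_div, div_le_iff₀ hn]
      linarith
    have hpw : ‖p - w‖ ≤ n * (r / 2) := by
      have h : 1 - 1 / (n + 1 : ℝ) = n / (n + 1) := by field_simp; ring
      rw [← dist_eq_norm, hp, dist_lineMap_right, h, Real.norm_eq_abs,
        abs_of_nonneg (by positivity), dist_eq_norm, div_mul_eq_mul_div, div_le_iff₀ hn]
      nlinarith [n.cast_nonneg (α := ℝ)]
    obtain ⟨g, g_bij, hg, g_supp, g_lip⟩ := exists_biLipschitz_push hr hvp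
    obtain ⟨G, G_bij, hG, G_supp, G_lip⟩ := ih p hpw
    refine ⟨G ∘ g, G_bij.comp g_bij, by simp [hg, hG], fun u hu => ?_, fun u u' => ⟨?_, ?_⟩⟩
    · rw [Function.comp_apply, g_supp u (hu v (left_mem_segment ℝ v w))]
      exact G_supp u fun x hx =>
        hu x ((convex_segment v w).segment_subset hp_mem (right_mem_segment ℝ v w) hx)
    · calc 1 / 2 ^ (n + 1) * ‖u - u'‖ = 1 / 2 ^ n * (1 / 2 * ‖u - u'‖) := by
            rw [pow_succ]; field_simp
        _ ≤ 1 / 2 ^ n * ‖g u - g u'‖ := by gcongr; exact (g_lip u u').1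
        _ ≤ _ := (G_lip _ _).1
    · calc _ ≤ 2 ^ n * ‖g u - g u'‖ := (G_lip _ _).2
        _ ≤ 2 ^ n * (2 * ‖u - u'‖) := by gcongr; exact (g_lip u u').2
        _ = 2 ^ (n + 1) * ‖u - u'‖ := by ring


/-- For d ≥ 2, any point v of ℝ^d can be moved to any other point w by a bi-Lipschitz
homeomorphism G of ℝ^d supported in the open (ε/2)-neighborhood of the segment [v, w],
whose bi-Lipschitz constant is bounded by a quantity depending only on d, ε and ‖v - w‖,
monotone in ‖v - w‖ (hence uniformly bounded over pairs (v, w) with ‖v - w‖ bounded). -/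
theorem biLipschitz_moving_point_along_segment :
    ∃ κ : ℕ → ℝ → ℝ → ℝ,
      ∀ (d : ℕ), 2 ≤ d → ∀ (ε : ℝ), 0 < ε → Monotone (κ d ε) ∧
        ∀ v w : EuclideanSpace ℝ (Fin d),
          ∃ G : EuclideanSpace ℝ (Fin d) → EuclideanSpace ℝ (Fin d), ∃ K : ℝ,
            1 ≤ K ∧ K ≤ κ d ε ‖v - w‖ ∧
            Function.Bijective G ∧
            G v = w ∧
            (∀ u : EuclideanSpace ℝ (Fin d),
              ¬ (Metric.infDist u (segment ℝ v w) < ε / 2) → G u = u) ∧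
            (∀ u u' : EuclideanSpace ℝ (Fin d),
              (1 / K) * ‖u - u'‖ ≤ ‖G u - G u'‖ ∧ ‖G u - G u'‖ ≤ K * ‖u - u'‖) := by
  refine ⟨fun _ ε t => 2 ^ ⌈t / (ε / 4)⌉₊, fun d _ ε hε => ⟨fun s t hst => ?_, fun v w => ?_⟩⟩
  · exact pow_le_pow_right₀ one_le_two (Nat.ceil_mono (by gcongr))
  · have hvw : ‖v - w‖ ≤ ⌈‖v - w‖ / (ε / 4)⌉₊ * (ε / 2 / 2) := by
      have h := Nat.le_ceil (‖v - w‖ / (ε / 4))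
      rw [div_le_iff₀ (by positivity)] at h
      linarith
    obtain ⟨G, bij, hG, supp, lip⟩ := exists_biLipschitz_chain (half_pos hε) _ v w hvw
    refine ⟨G, _, one_le_pow₀ one_le_two, le_rfl, bij, hG, fun u hu => supp u fun x hx => ?_, lip⟩
    exact (not_lt.mp hu).trans (Metric.infDist_le_dist_of_mem hx)
end

section
/- Let w ∈ ℝ² and ε > 0. Then there exists a bi-Lipschitz homeomorphism T : ℝ² → ℝ² (a half Dehn twist) such that T(u) = u for every u outside the open ball B(w, ε/3), T coincides with the rotation of angle π about w on the circle of center w and radius ε/6, and the bi-Lipschitz constant of T is bounded above by a universal constant independent of w and ε. -/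
/-- The map of the plane that rotates the circle of radius `r` about the origin by angle `φ r`. -/
noncomputable def radialTwist (φ : ℝ → ℝ) (z : ℂ) : ℂ :=
  Complex.exp (φ ‖z‖ * Complex.I) * z

theorem norm_radialTwist (φ : ℝ → ℝ) (z : ℂ) : ‖radialTwist φ z‖ = ‖z‖ := by
  rw [radialTwist, norm_mul, Complex.norm_exp_ofReal_mul_I, one_mul]

theorem radialTwist_neg_radialTwist (φ : ℝ → ℝ) (z : ℂ) :
    radialTwist (-φ) (radialTwist φ z) = z := by
  rw [radialTwist, norm_radialTwist, radialTwist, ← mul_assoc, ← Complex.exp_add]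
  simp

theorem radialTwist_radialTwist_neg (φ : ℝ → ℝ) (z : ℂ) :
    radialTwist φ (radialTwist (-φ) z) = z := by
  simpa using radialTwist_neg_radialTwist (-φ) z

theorem norm_exp_ofReal_mul_I_sub_le (a b : ℝ) :
    ‖Complex.exp (a * Complex.I) - Complex.exp (b * Complex.I)‖ ≤ |a - b| := by
  have h : Complex.exp (a * Complex.I) - Complex.exp (b * Complex.I) =
      Complex.exp (b * Complex.I) * (Complex.exp (Complex.I * (a - b : ℝ)) - 1) := by
    rw [mul_sub, ← Complex.exp_add, mul_one]
    congr 2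
    push_cast
    ring
  rw [h, norm_mul, Complex.norm_exp_ofReal_mul_I, one_mul]
  exact Real.norm_exp_I_mul_ofReal_sub_one_le

/-- A twist whose angle is `L`-Lipschitz and vanishes from radius `R` on is
`(1 + L * R)`-Lipschitz. -/
theorem norm_radialTwist_sub_le {φ : ℝ → ℝ} {L R : ℝ} (hL : 0 ≤ L) (hR : 0 ≤ R)
    (hφ : ∀ r s, |φ r - φ s| ≤ L * |r - s|) (hφR : ∀ r, R ≤ r → φ r = 0) (z z' : ℂ) :
    ‖radialTwist φ z - radialTwist φ z'‖ ≤ (1 + L * R) * ‖z - z'‖ := by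
  wlog h : ‖z‖ ≤ ‖z'‖ generalizing z z'
  · rw [norm_sub_rev, norm_sub_rev z]
    exact this z' z (le_of_not_ge h)
  have hLR : 0 ≤ L * R * ‖z - z'‖ := by positivity
  rcases le_total R ‖z‖ with hz | hz
  · simp only [radialTwist, hφR _ hz, hφR _ (hz.trans h)]
    simp only [Complex.ofReal_zero, zero_mul, Complex.exp_zero, one_mul]
    linarith
  · have hsplit : radialTwist φ z - radialTwist φ z' =
        Complex.exp (φ ‖z'‖ * Complex.I) * (z - z') +
          (Complex.exp (φ ‖z‖ * Complex.I) - Complex.exp (φ ‖z'‖ * Complex.I)) * z := by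
      simp only [radialTwist]
      ring
    have hangle : |φ ‖z‖ - φ ‖z'‖| ≤ L * ‖z - z'‖ :=
      (hφ _ _).trans (mul_le_mul_of_nonneg_left (abs_norm_sub_norm_le z z') hL)
    calc ‖radialTwist φ z - radialTwist φ z'‖
        ≤ ‖z - z'‖ + |φ ‖z‖ - φ ‖z'‖| * ‖z‖ := by
          rw [hsplit]
          refine (norm_add_le _ _).trans ?_
          rw [norm_mul, norm_mul, Complex.norm_exp_ofReal_mul_I, one_mul]
          gcongr
          exact norm_exp_ofReal_mul_I_sub_le _ _
      _ ≤ ‖z - z'‖ + L * ‖z - z'‖ * R := by gcongr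
      _ = (1 + L * R) * ‖z - z'‖ := by ring

/-- The angle equal to `π` up to radius `ρ`, to `0` from radius `2 * ρ` on, and affine between. -/
noncomputable def halfTwistAngle (ρ r : ℝ) : ℝ :=
  Real.pi * max 0 (min 1 (2 - r / ρ))

theorem halfTwistAngle_self {ρ : ℝ} (hρ : 0 < ρ) : halfTwistAngle ρ ρ = Real.pi := by
  rw [halfTwistAngle, div_self hρ.ne']
  norm_num

theorem halfTwistAngle_of_le {ρ r : ℝ} (hρ : 0 < ρ) (hr : 2 * ρ ≤ r) :
    halfTwistAngle ρ r = 0 := by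
  have h : 2 ≤ r / ρ := (le_div_iff₀ hρ).2 hr
  rw [halfTwistAngle, max_eq_left ((min_le_right _ _).trans (by linarith)), mul_zero]

theorem abs_halfTwistAngle_sub_le {ρ : ℝ} (hρ : 0 < ρ) (r s : ℝ) :
    |halfTwistAngle ρ r - halfTwistAngle ρ s| ≤ Real.pi / ρ * |r - s| := by
  have hclamp : |max 0 (min 1 (2 - r / ρ)) - max 0 (min 1 (2 - s / ρ))| ≤
      |(2 - r / ρ) - (2 - s / ρ)| := by
    rw [max_comm 0, max_comm 0]
    refine (abs_max_sub_max_le_abs (min 1 (2 - r / ρ)) (min 1 (2 - s / ρ)) 0).trans ?_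
    simpa using abs_min_sub_min_le_max 1 (2 - r / ρ) 1 (2 - s / ρ)
  have hscale : |(2 - r / ρ) - (2 - s / ρ)| = |r - s| / ρ := by
    rw [show (2 - r / ρ) - (2 - s / ρ) = (s - r) / ρ by ring, abs_div, abs_of_pos hρ, abs_sub_comm]
  rw [halfTwistAngle, halfTwistAngle, ← mul_sub, abs_mul, abs_of_pos Real.pi_pos, div_mul_eq_mul_div,
    mul_div_assoc, ← hscale]
  exact mul_le_mul_of_nonneg_left hclamp Real.pi_pos.le


/-- Half Dehn twist: there is a universal constant K such that for every w ∈ ℝ² and ε > 0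
there is a K-bi-Lipschitz homeomorphism T of ℝ² which is the identity outside the open
ball B(w, ε/3) and coincides with the rotation of angle π about w (i.e. u ↦ 2w - u)
on the circle of center w and radius ε/6. -/
theorem half_dehn_twist_biLipschitz :
    ∃ K : ℝ, 1 ≤ K ∧
      ∀ (w : EuclideanSpace ℝ (Fin 2)) (ε : ℝ), 0 < ε →
        ∃ T : EuclideanSpace ℝ (Fin 2) → EuclideanSpace ℝ (Fin 2),
          Function.Bijective T ∧
          (∀ u : EuclideanSpace ℝ (Fin 2), u ∉ Metric.ball w (ε / 3) → T u = u) ∧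
          (∀ u : EuclideanSpace ℝ (Fin 2), ‖u - w‖ = ε / 6 → T u = (2 : ℝ) • w - u) ∧
          (∀ u u' : EuclideanSpace ℝ (Fin 2),
            (1 / K) * ‖u - u'‖ ≤ ‖T u - T u'‖ ∧ ‖T u - T u'‖ ≤ K * ‖u - u'‖) := by
  have hπ := Real.pi_pos
  refine ⟨1 + 2 * Real.pi, by linarith, fun w ε hε => ?_⟩
  have hρ : 0 < ε / 6 := by positivity
  set φ : ℝ → ℝ := halfTwistAngle (ε / 6) with hφ
  let e : ℂ ≃ₗᵢ[ℝ] EuclideanSpace ℝ (Fin 2) := Complex.orthonormalBasisOneI.repr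
  let F : (ℝ → ℝ) → EuclideanSpace ℝ (Fin 2) → EuclideanSpace ℝ (Fin 2) :=
    fun ψ u => w + e (radialTwist ψ (e.symm (u - w)))
  have hdiff : ∀ ψ u u', ‖F ψ u - F ψ u'‖ =
      ‖radialTwist ψ (e.symm (u - w)) - radialTwist ψ (e.symm (u' - w))‖ := fun ψ u u' => by
    simp only [F]
    rw [add_sub_add_left_eq_sub, ← map_sub, e.norm_map]
  have hdiff' : ∀ u u', ‖e.symm (u - w) - e.symm (u' - w)‖ = ‖u - u'‖ := fun u u' => by
    rw [← map_sub, e.symm.norm_map, sub_sub_sub_cancel_right]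
  have hconst : 1 + Real.pi / (ε / 6) * (2 * (ε / 6)) = 1 + 2 * Real.pi := by
    field_simp
  have hlip : ∀ u u', ‖F φ u - F φ u'‖ ≤ (1 + 2 * Real.pi) * ‖u - u'‖ := fun u u' => by
    rw [hdiff, ← hdiff' u u', ← hconst]
    exact norm_radialTwist_sub_le (by positivity) (by positivity)
      (abs_halfTwistAngle_sub_le hρ) (fun r => halfTwistAngle_of_le hρ) _ _
  have hlip_neg : ∀ u u', ‖F (-φ) u - F (-φ) u'‖ ≤ (1 + 2 * Real.pi) * ‖u - u'‖ :=
    fun u u' => by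
      rw [hdiff, ← hdiff' u u', ← hconst]
      refine norm_radialTwist_sub_le (by positivity) (by positivity) (fun r s => ?_)
        (fun r hr => ?_) _ _
      · rw [Pi.neg_apply, Pi.neg_apply, neg_sub_neg, abs_sub_comm]
        exact abs_halfTwistAngle_sub_le hρ r s
      · rw [Pi.neg_apply, hφ, halfTwistAngle_of_le hρ hr, neg_zero]
  have hleft : Function.LeftInverse (F (-φ)) (F φ) := fun u => by
    simp [F, radialTwist_neg_radialTwist]
  have hright : Function.RightInverse (F (-φ)) (F φ) := fun u => by
    simp [F, radialTwist_radialTwist_neg]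
  refine ⟨F φ, ⟨hleft.injective, hright.surjective⟩, fun u hu => ?_, fun u hu => ?_,
    fun u u' => ⟨?_, hlip u u'⟩⟩
  · have hr : 2 * (ε / 6) ≤ ‖u - w‖ := by
      rw [Metric.mem_ball, dist_eq_norm, not_lt] at hu
      linarith
    simp only [F, radialTwist, e.symm.norm_map, hφ, halfTwistAngle_of_le hρ hr]
    simp
  · simp only [F, radialTwist, e.symm.norm_map, hu, hφ, halfTwistAngle_self hρ,
      Complex.exp_pi_mul_I]
    rw [neg_one_mul, map_neg, e.apply_symm_apply, two_smul]
    abel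
  · rw [one_div, inv_mul_le_iff₀ (by linarith)]
    simpa only [hleft u, hleft u'] using hlip_neg (F φ u) (F φ u')
end
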